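/- Let O be a W-orbit in ℝ^r and t ∈ T_O. The operators Y_1^O, …, Y_r^O on F[O] pairwise commute: Y_i^O ∘ Y_j^O = Y_j^O ∘ Y_i^O for all 1 ≤ i, j ≤ r. -/

import Mathlib

open scoped Classical

noncomputable section

namespace QP

/-! ### The space of quasi-polynomials -/

/-- Euclidean space `ℝ^r`. -/
abbrev E (r : ℕ) := Fin r → ℝ

variable (F : Type*) [Field F] [CharZero F] (r : ℕ)

/-- The algebra of quasi-polynomials `F[ℝ^r]`: the group algebra of `(ℝ^r,+)` over `F`. -/
abbrev QA := AddMonoidAlgebra F (E r)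

/-- The quasi-monomial `x^y`. -/
def X (y : E r) : QA F r := AddMonoidAlgebra.single y 1

/-- The `i`-th coordinate of a vector (`1`-based). -/
def cd (y : E r) (i : ℕ) : ℝ := ∑ m : Fin r, if (m : ℕ) + 1 = i then y m else 0

/-- The standard basis vector `ε_i` (`1`-based). -/
def epsV (i : ℕ) : E r := fun m => if (m : ℕ) + 1 = i then 1 else 0

/-- The standard basis vector (`0`-based). -/
def eV (m : Fin r) : E r := fun n => if n = m then 1 else 0

/-- The Euclidean inner product on `ℝ^r`. -/
def ip (v y : E r) : ℝ := ∑ m : Fin r, v m * y m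

/-- An integral vector regarded as an element of `ℝ^r`. -/
def zc (lam : Fin r → ℤ) : E r := fun m => (lam m : ℝ)

/-- The simple reflections of the hyperoctahedral group `W₀ = S_r ⋉ (±1)^r` (`1`-based):
for `1 ≤ i < r`, `sW i` interchanges the `i`-th and `(i+1)`-st coordinates, and
`sW r` negates the last coordinate. -/
def sW (i : ℕ) (y : E r) : E r := fun m =>
  if i = r then (if (m : ℕ) + 1 = r then -y m else y m)
  else if (m : ℕ) + 1 = i then cd r y (i + 1)
  else if (m : ℕ) = i then cd r y i
  else y m

/-- `s_{ε₁} = s₁⋯s_{r-1} s_r s_{r-1}⋯s₁`: negation of the first coordinate. -/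
def sEps1 (y : E r) : E r := fun m => if (m : ℕ) = 0 then -y m else y m

/-- The affine simple reflection `s₀ = τ(ε₁) s_{ε₁} : y ↦ (1 - y₁, y₂, …, y_r)`, together
with `genF j = sW j` for `1 ≤ j ≤ r`: the Coxeter generators of the affine Weyl group
`W = W₀ ⋉ ℤ^r`. -/
def genF (j : ℕ) (y : E r) : E r :=
  if j = 0 then fun m => if (m : ℕ) = 0 then 1 - y m else y m
  else sW r j y

/-- The action of the word `s_{j₁} ⋯ s_{j_ℓ}` on `ℝ^r`. -/
def wordAct (l : List ℕ) (y : E r) : E r := l.foldr (genF r) y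

/-- The closure of the fundamental alcove
`C₊ = {y : 0 < y_r < ⋯ < y₁ < 1/2}`. -/
def CplusCl : Set (E r) :=
  {y | (∀ i j : Fin r, i ≤ j → y j ≤ y i) ∧ ∀ m : Fin r, 0 ≤ y m ∧ y m ≤ 1 / 2}

/-- The `W`-orbit of a point of `ℝ^r`. -/
def orbit (y : E r) : Set (E r) :=
  {z | ∃ l : List ℕ, (∀ a ∈ l, a ≤ r) ∧ wordAct r l y = z}

/-- `O` is a `W`-orbit in `ℝ^r`. -/
def IsOrbit (O : Set (E r)) : Prop := ∃ y, O = orbit r y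

/-- `c^𝒪`: the unique point of the orbit `O` lying in the closed fundamental alcove. -/
def cpt (O : Set (E r)) : E r :=
  if h : ∃ c, c ∈ O ∧ c ∈ CplusCl r then h.choose else 0

/-- The length of an element of the affine Weyl group `W` (as a map on `ℝ^r`). -/
def wlen (g : E r → E r) : ℕ :=
  sInf {n | ∃ l : List ℕ, (∀ a ∈ l, a ≤ r) ∧ l.length = n ∧ (fun y => wordAct r l y) = g}

/-- A choice of a shortest word `l` whose inverse maps `y` into the closed alcove;
the corresponding element of `W` is `g_y`. -/
def gW (y : E r) : List ℕ :=
  if h : ∃ l : List ℕ, (∀ a ∈ l, a ≤ r) ∧ wordAct r l.reverse y ∈ CplusCl r ∧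
      ∀ l' : List ℕ, (∀ a ∈ l', a ≤ r) → wordAct r l'.reverse y ∈ CplusCl r →
        l.length ≤ l'.length
  then h.choose else []

/-- `g_y`, the unique shortest element of `W` with `g_y⁻¹ y` in the closed alcove. -/
def gfun (y : E r) : E r → E r := fun z => wordAct r (gW r y) z

/-- The Bruhat order on `(W, {s₀,…,s_r})`, via the subword characterisation. -/
def bruhatLE (u v : E r → E r) : Prop :=
  ∃ l : List ℕ, (∀ a ∈ l, a ≤ r) ∧ (fun z => wordAct r l z) = v ∧ l.length = wlen r v ∧
    ∃ l' : List ℕ, l'.Sublist l ∧ (fun z => wordAct r l' z) = u ∧ l'.length = wlen r u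

/-- The partial order on `ℝ^r`: `y' ≤ y` iff `y'` and `y` lie in the same `W`-orbit and
`g_{y'} ≤_B g_y` in the Bruhat order. -/
def qle (y' y : E r) : Prop :=
  (∃ l : List ℕ, (∀ a ∈ l, a ≤ r) ∧ wordAct r l y = y') ∧ bruhatLE r (gfun r y') (gfun r y)

/-- Strict version of `qle`. -/
def qlt (y' y : E r) : Prop := qle r y' y ∧ y' ≠ y

/-- The `F`-linear operator on `F[ℝ^r]` determined by its values on the quasi-monomials. -/
def mkOp (Ψ : E r → QA F r) : Module.End F (QA F r) :=
  Finsupp.linearCombination F Ψ ∘ₗ (AddMonoidAlgebra.coeffLinearEquiv F).toLinearMap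

/-- `F[O] = span_F {x^y : y ∈ O}`. -/
def FO (O : Set (E r)) : Submodule F (QA F r) :=
  Submodule.span F {p | ∃ y ∈ O, p = X F r y}

/-- The Laurent polynomial subalgebra `F[ℤ^r] = span_F {x^μ : μ ∈ ℤ^r}`. -/
def Lspan : Submodule F (QA F r) :=
  Submodule.span F {p | ∃ lam : Fin r → ℤ, p = X F r (zc r lam)}

/-- `span_F {x^{y'} : y' < y}`. -/
def ltSpan (y : E r) : Submodule F (QA F r) :=
  Submodule.span F {p | ∃ y', qlt r y' y ∧ p = X F r y'}

/-! ### Floors and indicator/sign functions -/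

/-- the largest even integer `≤ z` -/
def floorE (z : ℝ) : ℤ := 2 * ⌊z / 2⌋
/-- the largest odd integer `≤ z` -/
def floorO (z : ℝ) : ℤ := 2 * ⌊(z + 1) / 2⌋ - 1
/-- indicator of `ℤ ⊆ ℝ` -/
def chiZ (z : ℝ) : ℕ := if ∃ n : ℤ, z = n then 1 else 0
/-- indicator of the even integers -/
def chiE (z : ℝ) : ℕ := if ∃ n : ℤ, z = 2 * n then 1 else 0
/-- indicator of the odd integers -/
def chiO (z : ℝ) : ℕ := if ∃ n : ℤ, z = 2 * n + 1 then 1 else 0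
/-- `η_e`: `1` on even integers `≥ 2`, `-1` on even integers `≤ 0`, `0` otherwise -/
def etaE (z : ℝ) : ℤ := if ∃ n : ℤ, z = 2 * n then (if 2 ≤ z then 1 else -1) else 0
/-- `η_o`: `1` on odd integers `≥ 1`, `-1` on odd integers `≤ -1`, `0` otherwise -/
def etaO (z : ℝ) : ℤ := if ∃ n : ℤ, z = 2 * n + 1 then (if 1 ≤ z then 1 else -1) else 0
/-- `η = η_e + η_o` -/
def eta (z : ℝ) : ℤ := etaE z + etaO z

/-- `geomS c v m` is the truncated geometric series `(1 - (c·x^v)^m)/(1 - c·x^v)`,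
a genuine element of `F[ℝ^r]`; it is the unique element with
`(1 - c·x^v) * geomS c v m = 1 - c^m·x^{m v}`. -/
def geomS (c : F) (v : E r) (m : ℤ) : QA F r :=
  if 0 ≤ m then ∑ t ∈ Finset.range m.toNat, c ^ (t : ℤ) • X F r ((t : ℝ) • v)
  else -∑ t ∈ Finset.range (-m).toNat, c ^ (-(t : ℤ) - 1) • X F r ((-(t : ℝ) - 1) • v)

/-! ### Truncated divided difference operators and Demazure–Lusztig operators -/

/-- `∇_i(x^y) = ((1 - (x_{i+1}/x_i)^{⌊y_i - y_{i+1}⌋})/(1 - x_i/x_{i+1}))·x^y`. -/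
def nablaIel (i : ℕ) (y : E r) : QA F r :=
  geomS F r 1 (epsV r i - epsV r (i + 1)) (-⌊cd r y i - cd r y (i + 1)⌋) * X F r y

/-- `∇_r^e(x^y) = ((1 - x_r^{-⌊2y_r⌋_e})/(1 - x_r^2))·x^y`. -/
def nablaReEl (y : E r) : QA F r :=
  geomS F r 1 ((2 : ℝ) • epsV r r) (-floorE (2 * cd r y r) / 2) * X F r y

/-- `∇_r^o(x^y) = ((x_r - x_r^{-⌊2y_r⌋_o})/(1 - x_r^2))·x^y`. -/
def nablaRoEl (y : E r) : QA F r :=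
  X F r (epsV r r) *
    geomS F r 1 ((2 : ℝ) • epsV r r) ((-floorO (2 * cd r y r) - 1) / 2) * X F r y

def nablaIop (i : ℕ) : Module.End F (QA F r) := mkOp F r (nablaIel F r i)
def nablaReOp : Module.End F (QA F r) := mkOp F r (nablaReEl F r)
def nablaRoOp : Module.End F (QA F r) := mkOp F r (nablaRoEl F r)

/-- The value of the truncated Demazure–Lusztig operator `T_i` (`1 ≤ i ≤ r`) on `x^y`. -/
def Tel (k kr ur : F) (i : ℕ) (y : E r) : QA F r :=
  if i = r then
    (kr ^ chiE (2 * cd r y r) * ur ^ chiO (2 * cd r y r)) • X F r (sW r r y)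
      + (kr - kr⁻¹) • nablaReEl F r y + (ur - ur⁻¹) • nablaRoEl F r y
  else
    k ^ chiZ (cd r y i - cd r y (i + 1)) • X F r (sW r i y)
      + (k - k⁻¹) • nablaIel F r i y

/-- The truncated Demazure–Lusztig operators `T_1, …, T_r` on `F[ℝ^r]`. -/
def Top (k kr ur : F) (i : ℕ) : Module.End F (QA F r) := mkOp F r (Tel F r k kr ur i)

/-! ### The torus and the affine generator -/

/-- `t^{ε_i}`: the `i`-th coordinate (`1`-based) of an element of the torus `T = (Fˣ)^r`. -/
def tcU (t : Fin r → Fˣ) (i : ℕ) : Fˣ := ∏ m : Fin r, if (m : ℕ) + 1 = i then t m else 1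

/-- `t^λ` for `λ ∈ ℤ^r`. -/
def upow (t : Fin r → Fˣ) (lam : Fin r → ℤ) : Fˣ := ∏ m : Fin r, t m ^ lam m

/-- `t^v` for a vector `v` with integral entries (entries read off via the floor). -/
def upowR (t : Fin r → Fˣ) (v : E r) : Fˣ := ∏ m : Fin r, t m ^ ⌊v m⌋

/-- The `W`-action on the torus `T = (Fˣ)^r`: for `g = τ(λ)w₀ ∈ W` (so `g y = w₀ y + λ`),
`(g t)_m = q^{λ_m} · t^{w₀⁻¹ ε_m}`, where `W₀` permutes and inverts coordinates and
`τ(λ) t = q^λ t`, with `q = (q^{1/2})²`. -/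
def torusAct (qh : Fˣ) (g : E r → E r) (t : Fin r → Fˣ) : Fin r → Fˣ := fun m =>
  (qh * qh) ^ ⌊g 0 m⌋ * ∏ j : Fin r, t j ^ ⌊(g (eV r j) - g 0) m⌋

/-- The action on the torus of the linear part of `g` alone (the `W₀`-action). -/
def torusAct0 (g : E r → E r) (t : Fin r → Fˣ) : Fin r → Fˣ := fun m =>
  ∏ j : Fin r, t j ^ ⌊(g (eV r j) - g 0) m⌋

/-- The simple affine roots `α₀(y) = 1 - 2y₁`, `α_i(y) = y_i - y_{i+1}` (`1 ≤ i < r`),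
`α_r(y) = 2 y_r` as affine-linear functionals. -/
def alphaF (j : ℕ) (y : E r) : ℝ :=
  if j = 0 then 1 - 2 * cd r y 1
  else if j = r then 2 * cd r y r
  else cd r y j - cd r y (j + 1)

/-- `t^{α_j^∨}` where `α₀^∨ = (-ε₁, 1/2)`, `α_i^∨ = (ε_i - ε_{i+1}, 0)`, `α_r^∨ = (ε_r, 0)`. -/
def tpowCo (qh : Fˣ) (t : Fin r → Fˣ) (j : ℕ) : Fˣ :=
  if j = 0 then qh * (tcU F r t 1)⁻¹
  else if j = r then tcU F r t r
  else tcU F r t j * (tcU F r t (j + 1))⁻¹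

/-- The affine subtorus `T_𝒪 = {t ∈ T : t^{α_j^∨} = 1 whenever α_j(c^𝒪) = 0}`. -/
def TOset (qh : Fˣ) (O : Set (E r)) : Set (Fin r → Fˣ) :=
  {t | ∀ j : ℕ, j ≤ r → alphaF r j (cpt r O) = 0 → tpowCo F r qh t j = 1}

/-- `∇₀^e(x^y) = ((1 - (q^{-1/2}x₁)^{⌊-2y₁⌋_e})/(1 - q x₁^{-2}))·x^y`. -/
def nabla0eEl (qh : F) (y : E r) : QA F r :=
  geomS F r (qh * qh) ((-2 : ℝ) • epsV r 1) (-floorE (-2 * cd r y 1) / 2) * X F r y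

/-- `∇₀^o(x^y) = ((q^{1/2}x₁^{-1} - (q^{-1/2}x₁)^{⌊-2y₁⌋_o})/(1 - q x₁^{-2}))·x^y`. -/
def nabla0oEl (qh : F) (y : E r) : QA F r :=
  (qh • X F r ((-1 : ℝ) • epsV r 1)) *
    geomS F r (qh * qh) ((-2 : ℝ) • epsV r 1) ((-floorO (-2 * cd r y 1) - 1) / 2) * X F r y

/-- The value of `T₀^𝒪` on `x^y`. -/
def T0el (qh : Fˣ) (k0 u0 : F) (t : Fin r → Fˣ) (y : E r) : QA F r :=
  (k0 ^ chiE (2 * cd r y 1) * u0 ^ chiO (2 * cd r y 1) *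
      ((tcU F r (torusAct F r qh (gfun r y) t) 1 : Fˣ) : F)) • X F r (sEps1 r y)
    + (k0 - k0⁻¹) • nabla0eEl F r qh y + (u0 - u0⁻¹) • nabla0oEl F r qh y

/-- The operator `T₀^𝒪` (as a globally defined operator; on `F[𝒪]` it is the operator of
the quasi-polynomial representation). -/
def T0op (qh : Fˣ) (k0 u0 : F) (t : Fin r → Fˣ) : Module.End F (QA F r) :=
  mkOp F r (T0el F r qh k0 u0 t)

/-- The full family `T₀^𝒪, T₁, …, T_r`. -/
def Tfull (qh : Fˣ) (k0 u0 k kr ur : F) (t : Fin r → Fˣ) (j : ℕ) : Module.End F (QA F r) :=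
  if j = 0 then T0op F r qh k0 u0 t else Top F r k kr ur j

/-- The Hecke parameter `k_j` (`k₀`, `k` or `k_r`). -/
def kpar (k0 k kr : F) (j : ℕ) : F := if j = 0 then k0 else if j = r then kr else k

/-- `(T_j^𝒪)⁻¹ = T_j^𝒪 - k_j + k_j⁻¹` (the inverse on `F[𝒪]`, by the Hecke relation). -/
def TfullInv (qh : Fˣ) (k0 u0 k kr ur : F) (t : Fin r → Fˣ) (j : ℕ) : Module.End F (QA F r) :=
  Tfull F r qh k0 u0 k kr ur t j - (kpar F r k0 k kr j - (kpar F r k0 k kr j)⁻¹) • 1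

/-- The word `0, 1, …, r-1, r, r-1, …, i` used in the definition of `Y_i^𝒪`. -/
def Ylist (i : ℕ) : List ℕ :=
  0 :: (((List.range (r - 1)).map (· + 1)) ++ [r] ++ ((List.range (r - i)).map fun m => r - 1 - m))

/-- The commuting operators
`Y_i^𝒪 = (T_{i-1}^𝒪)⁻¹⋯(T₁^𝒪)⁻¹ · T₀^𝒪 · T₁^𝒪⋯T_{r-1}^𝒪 · T_r^𝒪 · T_{r-1}^𝒪⋯T_i^𝒪`. -/
def Yop (qh : Fˣ) (k0 u0 k kr ur : F) (t : Fin r → Fˣ) (i : ℕ) : Module.End F (QA F r) :=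
  ((((List.range (i - 1)).map (· + 1)).reverse.map (TfullInv F r qh k0 u0 k kr ur t)).prod) *
    (((Ylist r i).map (Tfull F r qh k0 u0 k kr ur t)).prod)

/-! ### The base points `𝔰^𝒪`, `𝔰_y` and the spectrum -/

/-- `n_i^𝒪` (with `c = c^𝒪`), resp. `m_i(y)` (with `c = y`). -/
def nO (c : E r) (m : Fin r) : ℤ :=
  (∑ j : Fin r, if m < j then eta (c m - c j) + eta (c m + c j) else 0) +
    ∑ j : Fin r, if j < m then eta (c j + c m) - eta (c j - c m) else 0

/-- The base point `𝔰^𝒪 ∈ T`. -/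
def sOtor (k0 u0 k kr ur : Fˣ) (O : Set (E r)) : Fin r → Fˣ := fun m =>
  (k0 * kr) ^ (-(chiE (2 * cpt r O m) : ℤ)) * (u0 * ur) ^ (chiO (2 * cpt r O m) : ℤ) *
    k ^ nO r (cpt r O) m

/-- The eigenvalue `γ_i^𝒪(y) = ((g_y(𝔰^𝒪·t))_i)⁻¹`. -/
def gammaO (qh k0 u0 k kr ur : Fˣ) (O : Set (E r)) (t : Fin r → Fˣ) (i : ℕ) (y : E r) : Fˣ :=
  (tcU F r (torusAct F r qh (gfun r y) fun m => sOtor F r k0 u0 k kr ur O m * t m) i)⁻¹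

/-- `𝔰_y ∈ T`. -/
def sfrak (k0 u0 k kr ur : Fˣ) (y : E r) : Fin r → Fˣ := fun m =>
  (k0 * kr) ^ etaE (2 * y m) * (u0 * ur) ^ etaO (2 * y m) * k ^ nO r y m

/-! ### Finite Weyl group combinatorics, positive roots -/

/-- The set of positive roots of type `C_r`. -/
def PhiPlus : Set (E r) :=
  {v | (∃ a b : Fin r, a < b ∧ v = eV r a - eV r b) ∨
       (∃ a b : Fin r, a < b ∧ v = eV r a + eV r b) ∨ ∃ a : Fin r, v = (2 : ℝ) • eV r a}

/-- The root system of type `C_r`. -/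
def Phi0 : Set (E r) := PhiPlus r ∪ {v | -v ∈ PhiPlus r}

/-- The normalisation factor `κ_w^𝒪 = ∏_{α ∈ Π(w)} 𝐤_α^{χ_e(α(c))}·𝐤_{α/2}^{-χ_o(α(c))}`,
where `Π(w) = {α ∈ Φ₀⁺ : wα ∈ -Φ₀⁺}`, `𝐤_α = 𝐤_{α/2} = k` for short roots and
`𝐤_α = k_r`, `𝐤_{α/2} = u_r` for long roots. -/
def kappaW (k kr ur : Fˣ) (w : E r → E r) (c : E r) : Fˣ :=
  (∏ p : Fin r × Fin r,
      if p.1 < p.2 ∧ -w (eV r p.1 - eV r p.2) ∈ PhiPlus r then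
        k ^ ((chiE (ip r (eV r p.1 - eV r p.2) c) : ℤ) - (chiO (ip r (eV r p.1 - eV r p.2) c) : ℤ))
      else 1) *
  (∏ p : Fin r × Fin r,
      if p.1 < p.2 ∧ -w (eV r p.1 + eV r p.2) ∈ PhiPlus r then
        k ^ ((chiE (ip r (eV r p.1 + eV r p.2) c) : ℤ) - (chiO (ip r (eV r p.1 + eV r p.2) c) : ℤ))
      else 1) *
  ∏ a : Fin r,
      if -w ((2 : ℝ) • eV r a) ∈ PhiPlus r then
        kr ^ (chiE (ip r ((2 : ℝ) • eV r a) c) : ℤ) * ur ^ (-(chiO (ip r ((2 : ℝ) • eV r a) c) : ℤ))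
      else 1

/-- Iterated application `T_{i₁}(T_{i₂}(⋯(T_{i_ℓ}(f))⋯))`. -/
def applyT (k kr ur : F) (l : List ℕ) (f : QA F r) : QA F r :=
  l.foldr (fun i g => Top F r k kr ur i g) f

/-- The length function of the finite Weyl group `W₀`. -/
def w0len (g : E r → E r) : ℕ :=
  sInf {n | ∃ l : List ℕ, (∀ a ∈ l, 1 ≤ a ∧ a ≤ r) ∧ l.length = n ∧ (fun y => wordAct r l y) = g}

/-- Membership in `W₀` (as maps on `ℝ^r`). -/
def IsW0fun (w : E r → E r) : Prop :=
  ∃ l : List ℕ, (∀ a ∈ l, 1 ≤ a ∧ a ≤ r) ∧ w = fun y => wordAct r l y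

/-- Membership in the parabolic subgroup `W_{0,𝒪}` generated by the `s_i`, `1 ≤ i ≤ r`,
with `α_i(c^𝒪) = 0`. -/
def IsWOOfun (O : Set (E r)) (u : E r → E r) : Prop :=
  ∃ l : List ℕ, (∀ a ∈ l, 1 ≤ a ∧ a ≤ r ∧ alphaF r a (cpt r O) = 0) ∧
    u = fun y => wordAct r l y

/-- `v ∈ W₀^𝒪`: `v ∈ W₀` of minimal length in its coset `v·W_{0,𝒪}`. -/
def MinRep (O : Set (E r)) (v : E r → E r) : Prop :=
  IsW0fun r v ∧ ∀ u, IsWOOfun r O u → w0len r v ≤ w0len r fun y => v (u y)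

/-- Membership in the affine Weyl group `W` (as maps on `ℝ^r`). -/
def IsWfun (g : E r → E r) : Prop :=
  ∃ l : List ℕ, (∀ a ∈ l, a ≤ r) ∧ g = fun y => wordAct r l y

/-- Membership in the parabolic subgroup `W_{J(𝒪)}` generated by the `s_j`, `j ∈ J(𝒪)`. -/
def IsWJfun (O : Set (E r)) (u : E r → E r) : Prop :=
  ∃ l : List ℕ, (∀ a ∈ l, a ≤ r ∧ alphaF r a (cpt r O) = 0) ∧ u = fun y => wordAct r l y

/-- The `W`-action on the Laurent polynomials `F[ℤ^r]` by `q`-dilations and reflections: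
`w(x^μ) = x^{wμ}` for `w ∈ W₀`, `τ(λ)(x^μ) = q^{-⟨μ,λ⟩} x^μ` (globally defined via the
linear/translation parts of `g`). -/
def LWact (qh : Fˣ) (g : E r → E r) : Module.End F (QA F r) :=
  mkOp F r fun v => (((qh * qh) ^ (-⌊ip r (g v - g 0) (g 0)⌋) : Fˣ) : F) • X F r (g v - g 0)

/-! ### roots `ᾱ_j`, torus reflections -/

/-- The finite simple roots `ᾱ₀ = -2ε₁`, `ᾱ_i = ε_i - ε_{i+1}`, `ᾱ_r = 2ε_r`
(as integral vectors). -/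
def abarI (j : ℕ) : Fin r → ℤ := fun m =>
  if j = 0 then (if (m : ℕ) = 0 then -2 else 0)
  else if j = r then (if (m : ℕ) + 1 = r then 2 else 0)
  else if (m : ℕ) + 1 = j then 1
  else if (m : ℕ) = j then -1
  else 0

/-- The corresponding coroots `ᾱ₀^∨ = -ε₁`, `ᾱ_i^∨ = ε_i - ε_{i+1}`, `ᾱ_r^∨ = ε_r`. -/
def abarV (j : ℕ) : Fin r → ℤ := fun m =>
  if j = 0 then (if (m : ℕ) = 0 then -1 else 0)
  else if j = r then (if (m : ℕ) + 1 = r then 1 else 0)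
  else if (m : ℕ) + 1 = j then 1
  else if (m : ℕ) = j then -1
  else 0

/-- `ᾱ_j` as a real vector. -/
def abarR (j : ℕ) : E r := fun m => ((abarI r j m : ℤ) : ℝ)

/-- The constants `c₀ = u₀u_r`, `c_i = k²`, `c_r = k₀k_r`. -/
def cpar (k0 u0 k kr ur : Fˣ) (j : ℕ) : Fˣ :=
  if j = 0 then u0 * ur else if j = r then k0 * kr else k * k

/-- The action of the reflection `s_{ᾱ_j} ∈ W₀` on the torus `T` (with `s_{ᾱ₀} = s_{ε₁}`). -/
def sTor (j : ℕ) (t : Fin r → Fˣ) : Fin r → Fˣ := fun m =>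
  if j = 0 then (if (m : ℕ) = 0 then (t m)⁻¹ else t m)
  else if j = r then (if (m : ℕ) + 1 = r then (t m)⁻¹ else t m)
  else if (m : ℕ) + 1 = j then tcU F r t (j + 1)
  else if (m : ℕ) = j then tcU F r t j
  else t m

/-! ### The operators `G_t^𝒪(a)` for affine roots `a = (α, n)` -/

/-- The coroot `α^∨ = 2α/⟨α,α⟩`. -/
def coroot (v : E r) : E r := ((2 : ℝ) / ip r v v) • v

/-- The scalar `q^{2n/⟨α,α⟩}` appearing in `x^{a^∨}` for `a = (α,n)`. -/
def qsc (qh : Fˣ) (v : E r) (n : ℤ) : Fˣ := if ip r v v = 4 then qh ^ n else (qh * qh) ^ n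

/-- `𝐤_a`: `k` if `α` is short; `k_r` if `α` long, `n` even; `k₀` if `α` long, `n` odd. -/
def kaf (k0 k kr : Fˣ) (v : E r) (n : ℤ) : Fˣ :=
  if ip r v v = 4 then (if Even n then kr else k0) else k

/-- `𝐤_{a/2}`: `k` if `α` is short; `u_r` if `α` long, `n` even; `u₀` if `α` long, `n` odd. -/
def khaf (u0 k ur : Fˣ) (v : E r) (n : ℤ) : Fˣ :=
  if ip r v v = 4 then (if Even n then ur else u0) else k

/-- The reflection `s_α(y) = y - α(y)·α^∨`. -/
def sRefl (v y : E r) : E r := y - ip r v y • coroot r v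

/-- `s_{a,t}(x^y) = (g_y t)^{-n α^∨} · x^{s_α y}`. -/
def saTel (qh : Fˣ) (t : Fin r → Fˣ) (v : E r) (n : ℤ) (y : E r) : QA F r :=
  ((upowR F r (torusAct F r qh (gfun r y) t) (((-n : ℤ) : ℝ) • coroot r v) : Fˣ) : F) •
    X F r (sRefl r v y)

/-- The twisted reflection operator `s_{a,t}`. -/
def SaOp (qh : Fˣ) (t : Fin r → Fˣ) (v : E r) (n : ℤ) : Module.End F (QA F r) :=
  mkOp F r (saTel F r qh t v n)

/-- The value `G_t^𝒪(a)(x^y)` for the affine root `a = (v, n)`. -/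
def Gel (qh k0 u0 k kr ur : Fˣ) (t : Fin r → Fˣ) (v : E r) (n : ℤ) (y : E r) : QA F r :=
  (((kaf F r k0 k kr v n : Fˣ) : F) ^ chiE (ip r v y) *
      ((khaf F r u0 k ur v n : Fˣ) : F) ^ chiO (ip r v y)) • X F r y
    + ((((kaf F r k0 k kr v n : Fˣ) : F) - ((kaf F r k0 k kr v n : Fˣ) : F)⁻¹) •
          geomS F r (((qsc F r qh v n)⁻¹ * (qsc F r qh v n)⁻¹ : Fˣ) : F)
            ((-2 : ℝ) • coroot r v) (-floorE (ip r v y) / 2)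
        + (((khaf F r u0 k ur v n : Fˣ) : F) - ((khaf F r u0 k ur v n : Fˣ) : F)⁻¹) •
          ((((qsc F r qh v n)⁻¹ : Fˣ) : F) • X F r ((-1 : ℝ) • coroot r v) *
            geomS F r (((qsc F r qh v n)⁻¹ * (qsc F r qh v n)⁻¹ : Fˣ) : F)
              ((-2 : ℝ) • coroot r v) (-(floorO (ip r v y) + 1) / 2))) *
      saTel F r qh t v n y

/-- The operator `G_t^𝒪(a)` for `a = (v, n)`. -/
def Gop (qh k0 u0 k kr ur : Fˣ) (t : Fin r → Fˣ) (v : E r) (n : ℤ) : Module.End F (QA F r) :=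
  mkOp F r (Gel F r qh k0 u0 k kr ur t v n)

/-- The twisted action `g_t` of `g ∈ W` on `F[𝒪]`:
`g_t(x^y) = (g_{w₀ y} t)^{-λ} x^{w₀ y}` for `g = τ(λ) w₀`. -/
def Wtw (qh : Fˣ) (t : Fin r → Fˣ) (g : E r → E r) : Module.End F (QA F r) :=
  mkOp F r fun y =>
    (((upowR F r (torusAct F r qh (gfun r (g y - g 0)) t) (g 0))⁻¹ : Fˣ) : F) •
      X F r (g y - g 0)

/-! ### The operators `D_j` -/

/-- The palindromic word `1, …, r-1, r, r-1, …, 1`. -/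
def palin : List ℕ :=
  ((List.range (r - 1)).map (· + 1)) ++ [r] ++ ((List.range (r - 1)).map (· + 1)).reverse

/-- Multiplication by `x^{-ε₁}`. -/
def Mop : Module.End F (QA F r) := mkOp F r fun y => X F r ((-1 : ℝ) • epsV r 1) * X F r y

/-- `D₀ = (T₁^𝒪 ⋯ T_{r-1}^𝒪 T_r^𝒪 T_{r-1}^𝒪 ⋯ T₁^𝒪)⁻¹ ∘ M`. -/
def D0op (qh : Fˣ) (k0 u0 k kr ur : F) (t : Fin r → Fˣ) : Module.End F (QA F r) :=
  ((palin r).map (TfullInv F r qh k0 u0 k kr ur t)).prod * Mop F r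

/-- `D_j`: `D₀` for `j = 0` and `T_j^𝒪` for `1 ≤ j ≤ r`. -/
def Dop (qh : Fˣ) (k0 u0 k kr ur : F) (t : Fin r → Fˣ) (j : ℕ) : Module.End F (QA F r) :=
  if j = 0 then D0op F r qh k0 u0 k kr ur t else Tfull F r qh k0 u0 k kr ur t j

/-- Iterated application `D_{j₁}(D_{j₂}(⋯(D_{j_ℓ}(f))⋯))`. -/
def applyD (qh : Fˣ) (k0 u0 k kr ur : F) (t : Fin r → Fˣ) (l : List ℕ) (f : QA F r) : QA F r :=
  l.foldr (fun j g => Dop F r qh k0 u0 k kr ur t j g) f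

/-- The coefficients `k_{s_j}(y)`. -/
def ksj (k kr ur : Fˣ) (j : ℕ) (y : E r) : Fˣ :=
  if j = 0 then
    kr ^ (-etaE (2 * cd r y 1)) * ur ^ (-etaO (2 * cd r y 1)) *
      ∏ m : Fin r,
        (if 1 ≤ (m : ℕ) then k ^ (-eta (cd r y 1 - y m) - eta (cd r y 1 + y m)) else 1)
  else if j = r then kr ^ (-etaE (2 * cd r y r)) * ur ^ (-etaO (2 * cd r y r))
  else k ^ (-eta (cd r y j - cd r y (j + 1)))

/-- `k_w(c) = ∏_m k_{s_{j_m}}(s_{j_{m+1}} ⋯ s_{j_ℓ} c)` for the word `w = s_{j₁} ⋯ s_{j_ℓ}`. -/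
def kword (k kr ur : Fˣ) (l : List ℕ) (z : E r) : Fˣ :=
  (l.foldr (fun j p => (genF r j p.1, ksj F r k kr ur j p.1 * p.2)) (z, (1 : Fˣ))).2


set_option linter.all false

/-! ### Commutation in the affine braid group -/

section BraidGroup

/-- `P_{r-n} = T_{r-n} ⋯ T_r ⋯ T_{r-n}`. -/
def Pg {G : Type*} [Monoid G] (T : ℕ → G) (r : ℕ) : ℕ → G
  | 0 => T r
  | n + 1 => T (r - n - 1) * Pg T r n * T (r - n - 1)

/-- `Yg n = Y_{n+1}`. -/
def Yg {G : Type*} [Group G] (T : ℕ → G) (r : ℕ) : ℕ → G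
  | 0 => T 0 * Pg T r (r - 1)
  | n + 1 => (T (n + 1))⁻¹ * Yg T r n * (T (n + 1))⁻¹

variable {G : Type*} [Group G] (T : ℕ → G) (r : ℕ)

theorem Pg_far (far : ∀ i j, i + 2 ≤ j → j ≤ r → Commute (T i) (T j)) (n : ℕ) :
    ∀ i, i + 2 + n ≤ r → Commute (T i) (Pg T r n) := by
  induction n with
  | zero => intro i hi; exact far i r (by omega) le_rfl
  | succ n ih =>
    intro i hi
    have h1 := far i (r - n - 1) (by omega) (by omega)
    exact (h1.mul_right (ih i (by omega))).mul_right h1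

theorem Pg_comm (far : ∀ i j, i + 2 ≤ j → j ≤ r → Commute (T i) (T j))
    (br3 : ∀ i, 1 ≤ i → i + 1 < r → T i * T (i + 1) * T i = T (i + 1) * T i * T (i + 1))
    (br4 : T (r - 1) * T r * T (r - 1) * T r = T r * T (r - 1) * T r * T (r - 1)) (n : ℕ) :
    ∀ j, n < r → r < n + j → j ≤ r → Commute (T j) (Pg T r n) := by
  induction n with
  | zero => intro j _ h1 h2; omega
  | succ n ih =>
    intro j hn hj hjr
    by_cases hj2 : r < n + j
    · have h1 := (far (r - n - 1) j (by omega) (by omega)).symm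
      exact (h1.mul_right (ih j (by omega) hj2 hjr)).mul_right h1
    · obtain rfl : j = r - n := by omega
      cases n with
      | zero =>
        simp only [Pg, Nat.sub_zero]
        rw [Commute, SemiconjBy]
        simp only [← mul_assoc]
        exact br4.symm
      | succ m =>
        obtain ⟨i, hi⟩ : ∃ i, r = i + m + 2 := ⟨r - m - 2, by omega⟩
        have e1 : r - (m + 1) - 1 = i := by omega
        have e2 : r - m - 1 = i + 1 := by omega
        have e3 : r - (m + 1) = i + 1 := by omega
        have hb := br3 i (by omega) (by omega)
        have hf : Commute (T i) (Pg T r m) := Pg_far T r far m i (by omega)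
        rw [Commute, SemiconjBy, e3]
        simp only [Pg, e1, e2]
        generalize Pg T r m = P at *
        calc T (i+1) * (T i * (T (i+1) * P * T (i+1)) * T i)
            = (T (i+1) * T i * T (i+1)) * P * T (i+1) * T i := by simp only [mul_assoc]
          _ = T i * T (i+1) * (T i * P) * T (i+1) * T i := by rw [← hb]; simp only [mul_assoc]
          _ = T i * T (i+1) * P * (T i * T (i+1) * T i) := by rw [hf.eq]; simp only [mul_assoc]
          _ = _ := by rw [hb]; simp only [mul_assoc]

/-- An element commuting with `T_j` for `j ≥ r - n` commutes with `P_{r-n}`. -/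
theorem Pg_comm_of (g : G) (n : ℕ) (hn : n ≤ r) (h : ∀ j, r ≤ n + j → j ≤ r → Commute g (T j)) :
    Commute g (Pg T r n) := by
  induction n with
  | zero => exact h r (by omega) le_rfl
  | succ n ih =>
    have h1 := h (r - n - 1) (by omega) (by omega)
    exact (h1.mul_right (ih (by omega) (fun j hj => h j (by omega)))).mul_right h1

theorem Yg_comm (hr : 2 ≤ r) (far : ∀ i j, i + 2 ≤ j → j ≤ r → Commute (T i) (T j))
    (br3 : ∀ i, 1 ≤ i → i + 1 < r → T i * T (i + 1) * T i = T (i + 1) * T i * T (i + 1))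
    (br4 : T (r - 1) * T r * T (r - 1) * T r = T r * T (r - 1) * T r * T (r - 1))
    (br0 : T 1 * T 0 * T 1 * T 0 = T 0 * T 1 * T 0 * T 1) :
    ∀ i j, i < r → j < r → Commute (Yg T r i) (Yg T r j) := by
  -- `Y_{n+1}` commutes with `T_j` for `j > n + 1`
  have hA : ∀ n j, n + 1 < j → j ≤ r → Commute (Yg T r n) (T j) := by
    intro n
    induction n with
    | zero =>
      intro j hj hjr
      exact (far 0 j (by omega) hjr).mul_left
        (Pg_comm T r far br3 br4 (r - 1) j (by omega) (by omega) hjr).symm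
    | succ n ih =>
      intro j hj hjr
      have h1 : Commute (T (n+1))⁻¹ (T j) := (far (n+1) j (by omega) hjr).inv_left
      exact (h1.mul_left (ih j (by omega) hjr)).mul_left h1
  -- `Y_{n+1}` commutes with `T_j` for `1 ≤ j < n`
  have hB : ∀ n j, 1 ≤ j → j < n → n < r → Commute (Yg T r n) (T j) := by
    intro n
    induction n with
    | zero => intro j _ h _; omega
    | succ n ih =>
      intro j hj hjn hnr
      by_cases hjn2 : j < n
      · have h1 : Commute (T (n+1))⁻¹ (T j) := (far j (n+1) (by omega) (by omega)).symm.inv_left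
        exact (h1.mul_left (ih j hj hjn2 (by omega))).mul_left h1
      · obtain rfl : j = n := by omega
        obtain ⟨m, rfl⟩ : ∃ m, j = m + 1 := ⟨j - 1, by omega⟩
        have hb := br3 (m+1) (by omega) (by omega)
        have hc := hA m (m+2) (by omega) (by omega)
        simp only [Yg]
        rw [Commute, SemiconjBy]
        change T (m+1) * T (m+2) * T (m+1) = T (m+2) * T (m+1) * T (m+2) at hb
        change _ * T (m+2) = T (m+2) * _ at hc
        change (T (m+2))⁻¹ * _ * (T (m+2))⁻¹ * T (m+1) = T (m+1) * ((T (m+2))⁻¹ * _ * (T (m+2))⁻¹)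
        generalize Yg T r m = y at *
        generalize T (m+1) = a at *
        generalize T (m+2) = b at *
        have e1 : a * b⁻¹ * a⁻¹ = b⁻¹ * a⁻¹ * b := by
          have : b⁻¹ * a⁻¹ * (b * a * b) * b⁻¹ * a⁻¹ = b⁻¹ * a⁻¹ * (a * b * a) * b⁻¹ * a⁻¹ := by
            rw [hb]
          have h2 : b⁻¹ * a⁻¹ * (a * b * a) * b⁻¹ * a⁻¹ = a * b⁻¹ * a⁻¹ := by group
          have h3 : b⁻¹ * a⁻¹ * (b * a * b) * b⁻¹ * a⁻¹ = b⁻¹ * a⁻¹ * b := by group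
          rw [← h2, ← h3, this]
        have e2 : a⁻¹ * b⁻¹ * a = b * a⁻¹ * b⁻¹ := by
          have : a⁻¹ * b⁻¹ * (a * b * a) * a⁻¹ * b⁻¹ = a⁻¹ * b⁻¹ * (b * a * b) * a⁻¹ * b⁻¹ := by
            rw [hb]
          have h2 : a⁻¹ * b⁻¹ * (a * b * a) * a⁻¹ * b⁻¹ = a⁻¹ * b⁻¹ * a := by group
          have h3 : a⁻¹ * b⁻¹ * (b * a * b) * a⁻¹ * b⁻¹ = b * a⁻¹ * b⁻¹ := by group
          rw [← h2, ← h3, this]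
        calc b⁻¹ * (a⁻¹ * y * a⁻¹) * b⁻¹ * a = b⁻¹ * a⁻¹ * y * (a⁻¹ * b⁻¹ * a) := by
              simp only [mul_assoc]
          _ = b⁻¹ * a⁻¹ * (y * b) * a⁻¹ * b⁻¹ := by rw [e2]; simp only [mul_assoc]
          _ = (b⁻¹ * a⁻¹ * b) * y * a⁻¹ * b⁻¹ := by rw [hc]; simp only [mul_assoc]
          _ = _ := by rw [← e1]; simp only [mul_assoc]
  -- `Y_1` commutes with `Y_2`
  have hC : Commute (Yg T r 0) (Yg T r 1) := by
    have eP : Pg T r (r - 1) = T 1 * Pg T r (r - 2) * T 1 := by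
      obtain ⟨s, rfl⟩ : ∃ s, r = s + 2 := ⟨r - 2, by omega⟩
      have : s + 2 - s - 1 = 1 := by omega
      simp only [Nat.add_sub_cancel, show s + 2 - 1 = s + 1 by omega, Pg, this]
    have h0 : Commute (T 0) (Pg T r (r - 2)) := Pg_far T r far (r - 2) 0 (by omega)
    have h1 : Commute (Pg T r (r - 1)) (Pg T r (r - 2)) :=
      Pg_comm_of T r _ (r - 2) (by omega) (fun j hj hjr =>
        (Pg_comm T r far br3 br4 (r - 1) j (by omega) (by omega) hjr).symm)
    simp only [Yg, zero_add]
    rw [eP] at h1 ⊢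
    generalize Pg T r (r - 2) = P at *
    generalize T 1 = a at *
    generalize T 0 = o at *
    have h1' : a * P * a * P = P * a * P * a := by
      have := h1.eq
      simpa only [mul_assoc] using this
    -- both sides equal `a⁻¹ * (…) * a⁻¹`
    have key : a * o * a * P * (o * (a * P * a)) = o * a * P * (o * (a * P * a)) * a := by
      calc a * o * a * P * (o * (a * P * a)) = a * o * a * (P * o) * a * P * a := by
            simp only [mul_assoc]
        _ = (a * o * a * o) * (P * a * P * a) := by rw [← h0.eq]; simp only [mul_assoc]
        _ = o * a * o * (a * P * a * P) * a := by rw [br0]; simp only [mul_assoc]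
        _ = o * a * (o * P) * a * P * a * a := by rw [h1']; simp only [mul_assoc]
        _ = _ := by rw [h0.eq]; simp only [mul_assoc]
    rw [Commute, SemiconjBy]
    calc (o * (a * P * a)) * (a⁻¹ * (o * (a * P * a)) * a⁻¹)
        = a⁻¹ * (a * o * a * P * (o * (a * P * a))) * a⁻¹ := by group
      _ = a⁻¹ * (o * a * P * (o * (a * P * a)) * a) * a⁻¹ := by rw [key]
      _ = _ := by group
  have hD : ∀ j, j < r → Commute (Yg T r 0) (Yg T r j) := by
    intro j
    induction j with
    | zero => intro _; exact Commute.refl _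
    | succ j ih =>
      intro hj
      cases j with
      | zero => exact hC
      | succ j =>
        have h1 := (hA 0 (j+2) (by omega) (by omega)).inv_right
        exact (h1.mul_right (ih (by omega))).mul_right h1
  have hE : ∀ i j, i < j → j < r → Commute (Yg T r i) (Yg T r j) := by
    intro i
    induction i with
    | zero => intro j _ hj; exact hD j hj
    | succ i ih =>
      intro j hij hj
      have h1 := (hB j (i+1) (by omega) hij hj).symm.inv_left
      exact (h1.mul_left (ih j (by omega) hj)).mul_left h1
  intro i j hi hj
  rcases lt_trichotomy i j with h | rfl | h
  · exact hE i j h hj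
  · exact Commute.refl _
  · exact (hE j i h hi).symm
end BraidGroup


/-! ### Rank two computations with the cross relations -/

section RankTwo

variable {K V : Type*} [Field K] [AddCommGroup V] [Module K V]

theorem quad_short (a X1 X2 : V →ₗ[K] V) (κ : K)
    (h1 : ∀ f, a (X1 f) = X2 (a f) - κ • X2 f)
    (h2 : ∀ f, a (X2 f) = X1 (a f) + κ • X2 f) (f : V) :
    a (a (X1 f)) - κ • a (X1 f) - X1 f = X1 (a (a f) - κ • a f - f) := by
  simp only [h1, h2, map_add, map_sub, map_smul, smul_add, smul_sub]
  module

theorem quad_long (b X Xi : V →ₗ[K] V) (κ μ : K) (hi : ∀ f, X (Xi f) = f) (hi' : ∀ f, Xi (X f) = f)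
    (h1 : ∀ f, b (X f) = Xi (b f) - κ • Xi f - μ • f) (f : V) :
    b (b (X f)) - κ • b (X f) - X f = X (b (b f) - κ • b f - f) := by
  have h2 : ∀ f, b (Xi f) = X (b f) + κ • Xi f + μ • f := by
    intro f
    have := congrArg X (h1 (Xi f))
    simp only [hi, map_sub, map_smul] at this
    rw [this]; module
  simp only [h1, h2, map_add, map_sub, map_smul, smul_add, smul_sub]
  module

theorem braid3_X (a b X1 X2 X3 : V →ₗ[K] V) (κ : K)
    (ha : ∀ f, a (a f) = κ • a f + f) (hb : ∀ f, b (b f) = κ • b f + f)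
    (a1 : ∀ f, a (X1 f) = X2 (a f) - κ • X2 f)
    (a2 : ∀ f, a (X2 f) = X1 (a f) + κ • X2 f)
    (a3 : ∀ f, a (X3 f) = X3 (a f))
    (b1 : ∀ f, b (X1 f) = X1 (b f))
    (b2 : ∀ f, b (X2 f) = X3 (b f) - κ • X3 f)
    (b3 : ∀ f, b (X3 f) = X2 (b f) + κ • X3 f) (f : V) :
    a (b (a (X1 f))) - b (a (b (X1 f))) = X3 (a (b (a f)) - b (a (b f))) ∧
    a (b (a (X3 f))) - b (a (b (X3 f))) = X1 (a (b (a f)) - b (a (b f))) := by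
  constructor <;>
  · simp only [a1, a2, a3, b1, b2, b3, ha, hb, map_add, map_sub, map_smul, smul_add, smul_sub]
    module

theorem braid3_T (a b : V →ₗ[K] V) (κ : K)
    (ha : ∀ f, a (a f) = κ • a f + f) (hb : ∀ f, b (b f) = κ • b f + f) (f : V) :
    a (b (a (a f))) - b (a (b (a f))) =
      κ • (a (b (a f)) - b (a (b f))) - b (a (b (a f)) - b (a (b f))) := by
  simp only [ha, hb, map_add, map_sub, map_smul, smul_add, smul_sub]
  module

theorem braid4_X (a b X1 X2 X1i X2i : V →ₗ[K] V) (κ κb μ : K)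
    (ha : ∀ f, a (a f) = κ • a f + f) (hb : ∀ f, b (b f) = κb • b f + f)
    (i1 : ∀ f, X1 (X1i f) = f) (i1' : ∀ f, X1i (X1 f) = f)
    (i2 : ∀ f, X2 (X2i f) = f) (i2' : ∀ f, X2i (X2 f) = f)
    (a1 : ∀ f, a (X1 f) = X2 (a f) - κ • X2 f)
    (a2 : ∀ f, a (X2 f) = X1 (a f) + κ • X2 f)
    (b1 : ∀ f, b (X1 f) = X1 (b f))
    (b2 : ∀ f, b (X2 f) = X2i (b f) - κb • X2i f - μ • f) (f : V) :
    a (b (a (b (X1 f)))) - b (a (b (a (X1 f)))) = X1i (a (b (a (b f))) - b (a (b (a f)))) ∧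
    a (b (a (b (X2 f)))) - b (a (b (a (X2 f)))) = X2i (a (b (a (b f))) - b (a (b (a f)))) := by
  have a3 : ∀ f, a (X1i f) = X2i (a f) + κ • X1i f := by
    intro f
    have := congrArg X2i (a1 (X1i f))
    simp only [i1, i2', map_sub, map_smul] at this
    rw [this]; module
  have a4 : ∀ f, a (X2i f) = X1i (a f) - κ • X1i f := by
    intro f
    have := congrArg X1i (a2 (X2i f))
    simp only [i2, i1', map_add, map_smul] at this
    rw [this]; module
  have b3 : ∀ f, b (X1i f) = X1i (b f) := by
    intro f
    have := congrArg X1i (b1 (X1i f))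
    simp only [i1, i1'] at this
    exact this.symm
  constructor <;>
  · simp only [a1, a2, a3, a4, b1, b2, b3, ha, hb, map_add, map_sub, map_smul, smul_add, smul_sub]
    module

theorem braid4_T (a b : V →ₗ[K] V) (κ κb : K)
    (ha : ∀ f, a (a f) = κ • a f + f) (hb : ∀ f, b (b f) = κb • b f + f) (f : V) :
    a (b (a (b (a f)))) - b (a (b (a (a f)))) =
      κ • (a (b (a (b f))) - b (a (b (a f)))) - a (a (b (a (b f))) - b (a (b (a f)))) ∧
    a (b (a (b (b f)))) - b (a (b (a (b f)))) =
      κb • (a (b (a (b f))) - b (a (b (a f)))) - b (a (b (a (b f))) - b (a (b (a f)))) := by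
  constructor <;>
  · simp only [ha, hb, map_add, map_sub, map_smul, smul_add, smul_sub]
    module

end RankTwo

/-! ### Basic facts on quasi-monomials -/

section Basics

variable {F r}

theorem mkOp_X (Ψ : E r → QA F r) (y : E r) : mkOp F r Ψ (X F r y) = Ψ y := by
  simp [mkOp, X]

theorem X_mul (v w : E r) : X F r v * X F r w = X F r (v + w) := by
  simp [X, AddMonoidAlgebra.single_mul_single]

theorem X_zero : X F r 0 = 1 := rfl

theorem QA_ind {p : QA F r → Prop} (hX : ∀ y, p (X F r y)) (hadd : ∀ f g, p f → p g → p (f + g))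
    (hs : ∀ (c : F) f, p f → p (c • f)) (f : QA F r) : p f := by
  have : f ∈ Submodule.span F (Set.range (X F r)) := by
    induction f using AddMonoidAlgebra.induction_linear with
    | zero => exact Submodule.zero_mem _
    | add f g hf hg => exact Submodule.add_mem _ hf hg
    | single y c =>
      have : AddMonoidAlgebra.single y c = c • X F r y := by simp [X]
      rw [this]
      exact Submodule.smul_mem _ _ (Submodule.subset_span ⟨y, rfl⟩)
  induction this using Submodule.span_induction with
  | mem x h => obtain ⟨y, rfl⟩ := h; exact hX y
  | zero => simpa using hs 0 _ (hX 0)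
  | add f g _ _ hf hg => exact hadd f g hf hg
  | smul c f _ hf => exact hs c f hf

theorem op_ext {A B : Module.End F (QA F r)} (h : ∀ y, A (X F r y) = B (X F r y)) : A = B := by
  apply LinearMap.ext
  intro f
  induction f using QA_ind with
  | hX y => exact h y
  | hadd f g hf hg => simp only [map_add, hf, hg]
  | hs c f hf => simp only [map_smul, hf]

theorem geomS_zero (c : F) (v : E r) : geomS F r c v 0 = 0 := by simp [geomS]

theorem geomS_succ (c : F) (hc : c ≠ 0) (v : E r) (m : ℤ) :
    geomS F r c v (m + 1) = 1 + (c • X F r v) * geomS F r c v m := by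
  rcases le_or_gt 0 m with h | h
  · obtain ⟨n, rfl⟩ := Int.eq_ofNat_of_zero_le h
    simp only [geomS, if_pos h, if_pos (show (0:ℤ) ≤ (n:ℤ) + 1 by omega)]
    rw [show ((n:ℤ)+1).toNat = n + 1 by omega, show ((n:ℤ)).toNat = n by omega,
      Finset.sum_range_succ', Finset.mul_sum, add_comm]
    congr 1
    · simp [X_zero]
    · refine Finset.sum_congr rfl fun t _ => ?_
      rw [smul_mul_smul_comm, X_mul]
      congr 1
      · push_cast; rw [zpow_add₀ hc]; simp [mul_comm]
      · congr 1; push_cast; module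
  · obtain ⟨n, hn⟩ : ∃ n : ℕ, m = -(n:ℤ) - 1 := ⟨(-m - 1).toNat, by omega⟩
    subst hn
    have e1 : geomS F r c v (-(n:ℤ) - 1 + 1) =
        -∑ t ∈ Finset.range n, c ^ (-(t : ℤ) - 1) • X F r ((-(t : ℝ) - 1) • v) := by
      cases n with
      | zero => simp [geomS]
      | succ n =>
        rw [geomS, if_neg (by push_cast; omega)]
        congr 2
    rw [e1, geomS, if_neg (by omega), show (-(-(n:ℤ) - 1)).toNat = n + 1 by omega,
      Finset.sum_range_succ', mul_neg, mul_add, Finset.mul_sum]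
    have e2 : c • X F r v * c ^ (-((0:ℕ):ℤ) - 1) • X F r ((-((0:ℕ):ℝ) - 1) • v) = 1 := by
      rw [smul_mul_smul_comm, X_mul]
      simp [hc, X_zero]
    have e3 : ∀ t : ℕ, c • X F r v * c ^ (-((t+1:ℕ):ℤ) - 1) • X F r ((-((t+1:ℕ):ℝ) - 1) • v) =
        c ^ (-(t:ℤ) - 1) • X F r ((-(t:ℝ) - 1) • v) := by
      intro t
      rw [smul_mul_smul_comm, X_mul]
      congr 1
      · rw [← zpow_one_add₀ hc]; congr 1; push_cast; ring
      · congr 1; push_cast; module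
    simp only [e2, e3]
    abel

theorem geomS_one (c : F) (hc : c ≠ 0) (v : E r) : geomS F r c v 1 = 1 := by
  have := geomS_succ c hc v 0
  simpa [geomS_zero] using this

/-- `z·S(m-1) = S(m) - 1`. -/
theorem geomS_pred (c : F) (hc : c ≠ 0) (v : E r) (m : ℤ) :
    (c • X F r v) * geomS F r c v (m - 1) = geomS F r c v m - 1 := by
  have := geomS_succ c hc v (m - 1)
  rw [sub_add_cancel] at this
  rw [this]; ring

theorem geomS_neg_one (c : F) (hc : c ≠ 0) (v : E r) :
    geomS F r c v (-1) = -(c⁻¹ • X F r (-v)) := by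
  have h := geomS_pred c hc v 0
  rw [geomS_zero, zero_sub] at h
  have h2 := congrArg (fun w => (c⁻¹ • X F r (-v)) * w) h
  simp only [← mul_assoc, smul_mul_smul_comm, X_mul] at h2
  simpa [hc, X_zero] using h2

end Basics


/-! ### Short and long Demazure–Lusztig operators -/

section Ops

variable {F r}

/-- standard basis vector -/
def ep (p : Fin r) : E r := Pi.single p 1

/-- interchange coordinates `p`, `q` -/
def sw (p q : Fin r) (y : E r) : E r := Function.update (Function.update y p (y q)) q (y p)

/-- negate coordinate `p` -/
def ng (p : Fin r) (y : E r) : E r := Function.update y p (-y p)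

/-- multiplication by a quasi-monomial -/
def MX (v : E r) : Module.End F (QA F r) := LinearMap.mulLeft F (X F r v)

theorem MX_apply (v : E r) (f : QA F r) : MX v f = X F r v * f := rfl

theorem MX_X (v y : E r) : MX v (X F r y) = X F r (v + y) := by rw [MX_apply, X_mul]

theorem MX_MX (v w : E r) (f : QA F r) : MX v (MX w f) = MX (v + w) f := by
  simp only [MX_apply, ← mul_assoc, X_mul]

theorem MX_zero (f : QA F r) : MX 0 f = f := by simp [MX_apply, X_zero]

/-- value of the short operator on a monomial -/
def SEl (k : F) (p q : Fin r) (e : ℝ) (y : E r) : QA F r :=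
  k ^ chiZ (e * (y p - y q)) • X F r (sw p q y)
    + (k - k⁻¹) • (geomS F r 1 (e • (ep p - ep q)) (-⌊e * (y p - y q)⌋) * X F r y)

/-- the short operator -/
def SO (k : F) (p q : Fin r) (e : ℝ) : Module.End F (QA F r) := mkOp F r (SEl k p q e)

/-- value of the long operator on a monomial -/
def LEl (kk uu c : F) (th : ℝ → F) (p : Fin r) (e : ℝ) (y : E r) : QA F r :=
  (kk ^ chiE (2 * y p) * uu ^ chiO (2 * y p) * th (e * y p)) • X F r (ng p y)
    + (kk - kk⁻¹) • (geomS F r (c * c) ((2 * e) • ep p) (-floorE (2 * e * y p) / 2) * X F r y)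
    + (uu - uu⁻¹) • ((c • X F r (e • ep p)) *
        geomS F r (c * c) ((2 * e) • ep p) ((-floorO (2 * e * y p) - 1) / 2) * X F r y)

/-- the long operator -/
def LO (kk uu c : F) (th : ℝ → F) (p : Fin r) (e : ℝ) : Module.End F (QA F r) :=
  mkOp F r (LEl kk uu c th p e)

theorem chiZ_add (z : ℝ) (n : ℤ) : chiZ (z + n) = chiZ z := by
  unfold chiZ
  congr 1
  apply propext
  constructor
  · rintro ⟨m, hm⟩; exact ⟨m - n, by push_cast; linarith⟩
  · rintro ⟨m, hm⟩; exact ⟨m + n, by push_cast; linarith⟩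

theorem chiE_add (z : ℝ) (n : ℤ) : chiE (z + 2 * n) = chiE z := by
  unfold chiE
  congr 1
  apply propext
  constructor
  · rintro ⟨m, hm⟩; exact ⟨m - n, by push_cast; linarith⟩
  · rintro ⟨m, hm⟩; exact ⟨m + n, by push_cast; linarith⟩

theorem chiO_add (z : ℝ) (n : ℤ) : chiO (z + 2 * n) = chiO z := by
  unfold chiO
  congr 1
  apply propext
  constructor
  · rintro ⟨m, hm⟩; exact ⟨m - n, by push_cast; linarith⟩
  · rintro ⟨m, hm⟩; exact ⟨m + n, by push_cast; linarith⟩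

theorem floorE_add (z : ℝ) : floorE (z + 2) = floorE z + 2 := by
  unfold floorE
  rw [show (z + 2) / 2 = z / 2 + 1 by ring, Int.floor_add_one]; ring

theorem floorO_add (z : ℝ) : floorO (z + 2) = floorO z + 2 := by
  unfold floorO
  rw [show (z + 2 + 1) / 2 = (z + 1) / 2 + 1 by ring, Int.floor_add_one]; ring

theorem ep_same (p : Fin r) : ep p p = 1 := by simp [ep]
theorem ep_ne {p q : Fin r} (h : q ≠ p) : ep p q = 0 := by simp [ep, h]

theorem sw_apply {p q : Fin r} (y : E r) (m : Fin r) :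
    sw p q y m = if m = q then y p else if m = p then y q else y m := by
  simp [sw, Function.update_apply]

theorem ng_apply {p : Fin r} (y : E r) (m : Fin r) :
    ng p y m = if m = p then -y p else y m := by
  simp [ng, Function.update_apply]

/-- a vector not involving `p`, `q` passes through the short operator -/
theorem SO_off (k : F) (p q : Fin r) (e : ℝ) (v : E r) (hp : v p = 0) (hq : v q = 0) (f : QA F r) :
    SO k p q e (MX v f) = MX v (SO k p q e f) := by
  induction f using QA_ind with
  | hadd f g hf hg => simp only [map_add, hf, hg]
  | hs c f hf => simp only [map_smul, hf]
  | hX y =>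
    rw [MX_X]
    simp only [SO, mkOp_X, SEl, Pi.add_apply, hp, hq, zero_add, map_add, map_smul, MX_X]
    rw [MX_apply, show sw p q (v + y) = v + sw p q y by
      ext m; simp only [sw_apply, Pi.add_apply]; split_ifs with h1 h2 <;> simp_all, ← X_mul v y]
    congr 2
    ring

theorem LO_off (kk uu c : F) (th : ℝ → F) (p : Fin r) (e : ℝ) (v : E r) (hp : v p = 0)
    (f : QA F r) : LO kk uu c th p e (MX v f) = MX v (LO kk uu c th p e f) := by
  induction f using QA_ind with
  | hadd f g hf hg => simp only [map_add, hf, hg]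
  | hs c f hf => simp only [map_smul, hf]
  | hX y =>
    rw [MX_X]
    simp only [LO, mkOp_X, LEl, Pi.add_apply, hp, zero_add, map_add, map_smul, MX_X]
    rw [MX_apply, MX_apply, show ng p (v + y) = v + ng p y by
      ext m; simp only [ng_apply, Pi.add_apply]; split_ifs with h1 <;> simp_all, ← X_mul v y]
    congr 2
    · congr 1
      ring
    · ring

theorem SO_Xp (k : F) (p q : Fin r) (hpq : p ≠ q) (e : ℝ) (he : e = 1 ∨ e = -1) (f : QA F r) :
    SO k p q e (MX (e • ep p) f) =
      MX (e • ep q) (SO k p q e f) - (k - k⁻¹) • MX (e • ep q) f := by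
  induction f using QA_ind with
  | hadd f g hf hg => simp only [map_add, hf, hg]; module
  | hs c f hf => simp only [map_smul, hf]; module
  | hX y =>
    rw [MX_X]
    have he2 : e * e = 1 := by rcases he with rfl | rfl <;> norm_num
    have ed : e * ((e • ep p + y) p - (e • ep p + y) q) = e * (y p - y q) + ((1:ℤ):ℝ) := by
      simp only [Pi.add_apply, Pi.smul_apply, ep_same, ep_ne hpq.symm, smul_eq_mul]
      push_cast; linear_combination he2
    have es : sw p q (e • ep p + y) = e • ep q + sw p q y := by
      ext m
      simp only [sw_apply, Pi.add_apply, Pi.smul_apply, smul_eq_mul]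
      by_cases h1 : m = q
      · subst h1; simp [ep_same]
      · by_cases h2 : m = p
        · subst h2; simp [h1, ep_ne hpq.symm, ep_ne h1]
        · simp [h1, h2, ep_ne h1, ep_ne h2]
    simp only [SO, mkOp_X, SEl, ed, es, chiZ_add, Int.floor_add_intCast, map_add, map_smul, MX_X]
    rw [MX_apply, ← X_mul (e • ep p) y, ← X_mul (e • ep q) y]
    have hg := geomS_pred (1:F) one_ne_zero (e • (ep p - ep q)) (-⌊e * (y p - y q)⌋)
    rw [one_smul] at hg
    have hx : X F r (e • ep p) = X F r (e • ep q) * X F r (e • (ep p - ep q)) := by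
      rw [X_mul]; congr 1; module
    rw [hx, show -(⌊e * (y p - y q)⌋ + 1) = -⌊e * (y p - y q)⌋ - 1 by ring, add_sub_assoc, ← smul_sub]
    congr 2
    linear_combination (X F r (e • ep q) * X F r y) * hg

theorem SO_Xq (k : F) (p q : Fin r) (hpq : p ≠ q) (e : ℝ) (he : e = 1 ∨ e = -1) (f : QA F r) :
    SO k p q e (MX (e • ep q) f) =
      MX (e • ep p) (SO k p q e f) + (k - k⁻¹) • MX (e • ep q) f := by
  induction f using QA_ind with
  | hadd f g hf hg => simp only [map_add, hf, hg]; module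
  | hs c f hf => simp only [map_smul, hf]; module
  | hX y =>
    rw [MX_X]
    have he2 : e * e = 1 := by rcases he with rfl | rfl <;> norm_num
    have ed : e * ((e • ep q + y) p - (e • ep q + y) q) = e * (y p - y q) + ((-1:ℤ):ℝ) := by
      simp only [Pi.add_apply, Pi.smul_apply, ep_same, ep_ne hpq, smul_eq_mul]
      push_cast; linear_combination -he2
    have es : sw p q (e • ep q + y) = e • ep p + sw p q y := by
      ext m
      simp only [sw_apply, Pi.add_apply, Pi.smul_apply, smul_eq_mul]
      by_cases h1 : m = q
      · subst h1; simp [ep_ne hpq, ep_ne hpq.symm]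
      · by_cases h2 : m = p
        · subst h2; simp [h1, ep_same]
        · simp [h1, h2, ep_ne h1, ep_ne h2]
    simp only [SO, mkOp_X, SEl, ed, es, chiZ_add, Int.floor_add_intCast, map_add, map_smul, MX_X]
    rw [MX_apply, ← X_mul (e • ep q) y]
    have hg := geomS_succ (1:F) one_ne_zero (e • (ep p - ep q)) (-⌊e * (y p - y q)⌋)
    rw [one_smul] at hg
    have hx : X F r (e • ep p) = X F r (e • ep q) * X F r (e • (ep p - ep q)) := by
      rw [X_mul]; congr 1; module
    rw [hx, show -(⌊e * (y p - y q)⌋ + -1) = -⌊e * (y p - y q)⌋ + 1 by ring, add_assoc, ← smul_add]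
    congr 2
    linear_combination (X F r (e • ep q) * X F r y) * hg

theorem LO_X (kk uu c : F) (hc : c ≠ 0) (th : ℝ → F) (hth : ∀ z, th (z + 1) = (c * c)⁻¹ * th z)
    (p : Fin r) (e : ℝ) (he : e = 1 ∨ e = -1) (f : QA F r) :
    LO kk uu c th p e ((c • MX (e • ep p) : Module.End F (QA F r)) f) =
      (c⁻¹ • MX (-(e • ep p)) : Module.End F (QA F r)) (LO kk uu c th p e f)
      - (kk - kk⁻¹) • (c⁻¹ • MX (-(e • ep p)) : Module.End F (QA F r)) f - (uu - uu⁻¹) • f := by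
  induction f using QA_ind with
  | hadd f g hf hg => simp only [map_add, hf, hg]; module
  | hs c f hf => simp only [map_smul, hf]; module
  | hX y =>
    have he2 : e * e = 1 := by rcases he with rfl | rfl <;> norm_num
    have ed1 : e * (e • ep p + y) p = e * y p + 1 := by
      simp only [Pi.add_apply, Pi.smul_apply, ep_same, smul_eq_mul]
      linear_combination he2
    have ed2 : 2 * e * (e • ep p + y) p = 2 * e * y p + 2 := by
      linear_combination 2 * ed1
    have ed3 : ∃ n : ℤ, 2 * (e • ep p + y) p = 2 * y p + 2 * n := by
      simp only [Pi.add_apply, Pi.smul_apply, ep_same, smul_eq_mul]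
      rcases he with rfl | rfl
      · exact ⟨1, by push_cast; ring⟩
      · exact ⟨-1, by push_cast; ring⟩
    obtain ⟨n, ed3⟩ := ed3
    have es : ng p (e • ep p + y) = -(e • ep p) + ng p y := by
      ext m
      simp only [ng_apply, Pi.add_apply, Pi.smul_apply, Pi.neg_apply, smul_eq_mul]
      by_cases h1 : m = p
      · subst h1; simp [ep_same]; ring
      · simp [h1, ep_ne h1]
    have eE : -(floorE (2 * e * y p) + 2) / 2 = -floorE (2 * e * y p) / 2 - 1 := by omega
    have eO : (-(floorO (2 * e * y p) + 2) - 1) / 2 = (-floorO (2 * e * y p) - 1) / 2 - 1 := by omega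
    simp only [LinearMap.smul_apply, map_smul, MX_X]
    simp only [LO, mkOp_X, LEl, ed1, ed2, ed3, es, chiE_add, chiO_add, floorE_add, floorO_add, hth,
      map_add, map_smul, MX_X, eE, eO]
    have hcc : c * c ≠ 0 := mul_ne_zero hc hc
    have hg1 := geomS_pred (c * c) hcc ((2 * e) • ep p) (-floorE (2 * e * y p) / 2)
    have hg2 := geomS_pred (c * c) hcc ((2 * e) • ep p) ((-floorO (2 * e * y p) - 1) / 2)
    generalize geomS F r (c * c) ((2 * e) • ep p) (-floorE (2 * e * y p) / 2 - 1) = A1 at *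
    generalize geomS F r (c * c) ((2 * e) • ep p) (-floorE (2 * e * y p) / 2) = A2 at *
    generalize geomS F r (c * c) ((2 * e) • ep p) ((-floorO (2 * e * y p) - 1) / 2 - 1) = B1 at *
    generalize geomS F r (c * c) ((2 * e) • ep p) ((-floorO (2 * e * y p) - 1) / 2) = B2 at *
    simp only [MX_apply]
    rw [← X_mul (e • ep p) y, ← X_mul (-(e • ep p)) (ng p y), ← X_mul (-(e • ep p)) y]
    have hx : X F r ((2 * e) • ep p) = X F r (e • ep p) * X F r (e • ep p) := by
      rw [X_mul]; congr 1; module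
    have hxi : X F r (-(e • ep p)) * X F r (e • ep p) = 1 := by
      rw [X_mul, neg_add_cancel, X_zero]
    rw [hx] at hg1 hg2
    clear hx es
    generalize X F r (e • ep p) = x at *
    generalize X F r (-(e • ep p)) = xi at *
    generalize X F r y = Y at *
    generalize X F r (ng p y) = Y' at *
    simp only [Algebra.smul_def] at *
    have hcc1 : algebraMap F (QA F r) c * algebraMap F (QA F r) c⁻¹ = 1 := by
      rw [← map_mul, mul_inv_cancel₀ hc, map_one]
    simp only [map_mul, mul_inv, map_sub, map_pow] at *
    generalize algebraMap F (QA F r) c = C at *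
    generalize algebraMap F (QA F r) c⁻¹ = Ci at *
    generalize algebraMap F (QA F r) kk = K at *
    generalize algebraMap F (QA F r) kk⁻¹ = Ki at *
    generalize algebraMap F (QA F r) uu = U at *
    generalize algebraMap F (QA F r) uu⁻¹ = Ui at *
    generalize algebraMap F (QA F r) (th (e * y p)) = H at *
    linear_combination (K ^ chiE (2 * y p) * U ^ chiO (2 * y p) * H * xi * Y' * Ci) * hcc1
      + (K - Ki) * (Ci * xi * Y * hg1 - (C * x * A1 * Y) * (xi * x * hcc1 + hxi))
      + (U - Ui) * (Y * hg2 - B2 * Y * (xi * x * hcc1 + hxi))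

end Ops


/-! ### Behaviour on dominant monomials, quadratic and braid relations -/

section Dom

variable {F r}

/-- scalar of the short operator on dominant monomials -/
def muS (k : F) (d : ℝ) : F := if d = 0 then k else if d = 1 then k⁻¹ else 1
/-- scalar of the long operator on dominant monomials -/
def muL (kk uu : F) (s : ℝ) : F := if s = 0 then kk else if s = 1 / 2 then uu⁻¹ else 1

theorem muS_ne (k : F) (hk : k ≠ 0) (d : ℝ) : muS k d ≠ 0 := by
  unfold muS; split_ifs <;> simp [hk]
theorem muL_ne (k u : F) (hk : k ≠ 0) (hu : u ≠ 0) (d : ℝ) : muL k u d ≠ 0 := by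
  unfold muL; split_ifs <;> simp [hk, hu]

theorem chiZ_int (n : ℤ) : chiZ (n : ℝ) = 1 := if_pos ⟨n, rfl⟩
theorem chiZ_of {d : ℝ} (n : ℤ) (h1 : n < d) (h2 : d < n + 1) : chiZ d = 0 := by
  apply if_neg
  rintro ⟨m, rfl⟩
  have h1' : n < m := by exact_mod_cast h1
  have h2' : m < n + 1 := by exact_mod_cast h2
  omega

theorem SO_dom (k : F) (hk : k ≠ 0) (p q : Fin r) (hpq : p ≠ q) (e : ℝ) (he : e = 1 ∨ e = -1)
    (y : E r) (h0 : 0 ≤ e * (y p - y q)) (h1 : e * (y p - y q) ≤ 1) :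
    SO k p q e (X F r y) = muS k (e * (y p - y q)) • X F r (sw p q y) := by
  have he2 : e * e = 1 := by rcases he with rfl | rfl <;> norm_num
  simp only [SO, mkOp_X, SEl]
  rcases eq_or_lt_of_le h1 with h | h
  · rw [h, show (1:ℝ) = ((1:ℤ):ℝ) by norm_num, chiZ_int, Int.floor_intCast,
      geomS_neg_one 1 one_ne_zero, neg_mul, inv_one, one_smul, X_mul]
    have : -(e • (ep p - ep q)) + y = sw p q y := by
      have h' : y p - y q = e := by linear_combination e * h - (y p - y q) * he2
      ext m
      simp only [sw_apply, Pi.add_apply, Pi.neg_apply, Pi.smul_apply, Pi.sub_apply, smul_eq_mul]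
      by_cases hm1 : m = q
      · subst hm1; simp [ep_same, ep_ne hpq.symm]; linarith
      · by_cases hm2 : m = p
        · subst hm2; simp [hm1, ep_same, ep_ne hm1]; linarith
        · simp [hm1, hm2, ep_ne hm1, ep_ne hm2]
    rw [this]
    simp [muS]
    module
  · have hf : ⌊e * (y p - y q)⌋ = 0 := by rw [Int.floor_eq_iff]; constructor <;> push_cast <;> linarith
    rw [hf, neg_zero, geomS_zero, zero_mul, smul_zero, add_zero]
    rcases eq_or_lt_of_le h0 with h' | h'
    · rw [← h', show (0:ℝ) = ((0:ℤ):ℝ) by norm_num, chiZ_int]; simp [muS]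
    · rw [chiZ_of 0 (by simpa using h') (by simpa using h), muS, if_neg h'.ne', if_neg h.ne, pow_zero]

theorem SO_neg (k : F) (p q : Fin r) (e : ℝ)
    (y : E r) (h0 : -1 < e * (y p - y q)) (h1 : e * (y p - y q) < 0) :
    SO k p q e (X F r y) = X F r (sw p q y) + (k - k⁻¹) • X F r y := by
  have hf : ⌊e * (y p - y q)⌋ = -1 := by
    rw [Int.floor_eq_iff]; constructor <;> push_cast <;> linarith
  simp only [SO, mkOp_X, SEl]
  rw [hf, neg_neg, geomS_one _ one_ne_zero,
    chiZ_of (-1) (by push_cast; exact h0) (by push_cast; linarith), pow_zero, one_smul, one_mul]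

theorem chiE_neg (z : ℝ) : chiE (-z) = chiE z := by
  unfold chiE
  congr 1
  apply propext
  constructor <;>
  · rintro ⟨m, hm⟩; exact ⟨-m, by push_cast; linarith⟩

theorem chiO_neg (z : ℝ) : chiO (-z) = chiO z := by
  unfold chiO
  congr 1
  apply propext
  constructor <;>
  · rintro ⟨m, hm⟩; exact ⟨-m - 1, by push_cast; linarith⟩

theorem chiE_of {d : ℝ} (n : ℤ) (h1 : 2 * n < d) (h2 : d < 2 * n + 2) : chiE d = 0 := by
  apply if_neg
  rintro ⟨m, rfl⟩
  have h1' : 2 * n < 2 * m := by exact_mod_cast h1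
  have h2' : 2 * m < 2 * n + 2 := by exact_mod_cast h2
  omega

theorem chiO_of {d : ℝ} (n : ℤ) (h1 : 2 * n - 1 < d) (h2 : d < 2 * n + 1) : chiO d = 0 := by
  apply if_neg
  rintro ⟨m, rfl⟩
  have h1' : 2 * n - 1 < 2 * m + 1 := by exact_mod_cast h1
  have h2' : 2 * m + 1 < 2 * n + 1 := by exact_mod_cast h2
  omega

theorem chi_e (e : ℝ) (he : e = 1 ∨ e = -1) (z : ℝ) :
    chiE (2 * z) = chiE (2 * (e * z)) ∧ chiO (2 * z) = chiO (2 * (e * z)) := by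
  rcases he with rfl | rfl
  · simp
  · rw [show 2 * (-1 * z) = -(2 * z) by ring, chiE_neg, chiO_neg]; simp

theorem LO_dom (kk uu c : F) (hk : kk ≠ 0) (hu : uu ≠ 0) (hc : c ≠ 0) (th : ℝ → F)
    (thh : th (1 / 2) = c⁻¹) (p : Fin r) (e : ℝ) (he : e = 1 ∨ e = -1)
    (y : E r) (h0 : 0 ≤ e * y p) (h1 : e * y p ≤ 1 / 2) :
    LO kk uu c th p e (X F r y) = (muL kk uu (e * y p) * th (e * y p)) • X F r (ng p y) := by
  have he2 : e * e = 1 := by rcases he with rfl | rfl <;> norm_num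
  simp only [LO, mkOp_X, LEl]
  rw [(chi_e e he (y p)).1, (chi_e e he (y p)).2, mul_assoc 2 e]
  have hfE : floorE (2 * (e * y p)) = 0 := by
    have : ⌊2 * (e * y p) / 2⌋ = 0 := by
      rw [Int.floor_eq_iff]; constructor <;> push_cast <;> linarith
    rw [floorE, this]; rfl
  rw [hfE]
  simp only [neg_zero, Int.zero_ediv, geomS_zero, zero_mul, smul_zero, add_zero]
  rcases eq_or_lt_of_le h1 with h | h
  · rw [h]
    have hfO : floorO (2 * (1 / 2)) = 1 := by
      have : ⌊((2:ℝ) * (1 / 2) + 1) / 2⌋ = 1 := by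
        rw [Int.floor_eq_iff]; constructor <;> norm_num
      rw [floorO, this]; rfl
    have c1 : chiE (2 * (1 / 2)) = 0 := chiE_of 0 (by norm_num) (by norm_num)
    have c2 : chiO (2 * (1 / 2)) = 1 := if_pos ⟨0, by norm_num⟩
    rw [hfO, c1, c2, show (-(1:ℤ) - 1) / 2 = -1 by norm_num,
      geomS_neg_one _ (mul_ne_zero hc hc), thh, mul_neg, smul_mul_smul_comm, X_mul, neg_mul,
      smul_mul_assoc, X_mul]
    have : e • ep p + -((2 * e) • ep p) + y = ng p y := by
      have h' : y p = e / 2 := by linear_combination e * h - y p * he2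
      ext m
      simp only [ng_apply, Pi.add_apply, Pi.neg_apply, Pi.smul_apply, smul_eq_mul]
      by_cases h1 : m = p
      · subst h1; simp [ep_same]; linarith
      · simp [h1, ep_ne h1]
    rw [this]
    have hm : muL kk uu (1/2) = uu⁻¹ := by simp [muL]
    rw [hm, smul_neg, smul_smul, ← sub_eq_add_neg, ← sub_smul]
    congr 1
    field_simp
    ring
  · have hfO : floorO (2 * (e * y p)) = -1 := by
      have : ⌊(2 * (e * y p) + 1) / 2⌋ = 0 := by
        rw [Int.floor_eq_iff]; constructor <;> push_cast <;> linarith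
      rw [floorO, this]; rfl
    rw [hfO, show (-(-1:ℤ) - 1) / 2 = 0 by norm_num]
    simp only [geomS_zero, zero_mul, smul_zero, add_zero, mul_zero]
    rw [chiO_of 0 (by push_cast; linarith) (by push_cast; linarith)]
    rcases eq_or_lt_of_le h0 with h' | h'
    · rw [← h', mul_zero, show chiE 0 = 1 from if_pos ⟨0, by simp⟩]; simp [muL]
    · rw [chiE_of 0 (by push_cast; linarith) (by push_cast; linarith), muL, if_neg h'.ne',
        if_neg h.ne]; simp

theorem LO_neg (kk uu c : F) (hc : c ≠ 0) (th : ℝ → F) (p : Fin r) (e : ℝ) (he : e = 1 ∨ e = -1)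
    (y : E r) (h0 : -1 / 2 ≤ e * y p) (h1 : e * y p < 0) :
    LO kk uu c th p e (X F r y) =
      ((if e * y p = -1 / 2 then uu else 1) * th (e * y p)) • X F r (ng p y)
        + (kk - kk⁻¹) • X F r y := by
  simp only [LO, mkOp_X, LEl]
  rw [(chi_e e he (y p)).1, (chi_e e he (y p)).2, mul_assoc 2 e]
  have hfE : floorE (2 * (e * y p)) = -2 := by
    have : ⌊2 * (e * y p) / 2⌋ = -1 := by
      rw [Int.floor_eq_iff]; constructor <;> push_cast <;> linarith
    rw [floorE, this]; rfl
  have hfO : floorO (2 * (e * y p)) = -1 := by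
    have : ⌊(2 * (e * y p) + 1) / 2⌋ = 0 := by
      rw [Int.floor_eq_iff]; constructor <;> push_cast <;> linarith
    rw [floorO, this]; rfl
  rw [hfE, hfO, show (-(-1:ℤ) - 1) / 2 = 0 by norm_num, show (-(-2:ℤ)) / 2 = 1 by norm_num,
    geomS_one _ (mul_ne_zero hc hc), chiE_of (-1) (by push_cast; linarith) (by push_cast; linarith)]
  simp only [geomS_zero, zero_mul, smul_zero, add_zero, mul_zero, one_mul, pow_zero]
  congr 3
  split_ifs with h
  · rw [h, show chiO (2 * (-1/2)) = 1 from if_pos ⟨-1, by norm_num⟩, pow_one]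
  · have : -1/2 < e * y p := lt_of_le_of_ne h0 (Ne.symm h)
    rw [chiO_of 0 (by push_cast; linarith) (by push_cast; linarith), pow_zero]

/-- Shifting a property along integer multiples of a vector. -/
theorem shift_closed (P : QA F r → Prop) (v : E r) (h1 : ∀ f, P f → P (MX v f))
    (h2 : ∀ f, P f → P (MX (-v) f)) (n : ℤ) (f : QA F r) (h : P f) : P (MX ((n:ℝ) • v) f) := by
  induction n using Int.induction_on with
  | zero => simpa [MX_zero] using h
  | succ n ih =>
    have := h1 _ ih
    rw [MX_MX] at this
    convert this using 3
    push_cast; module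
  | pred n ih =>
    have := h2 _ ih
    rw [MX_MX] at this
    convert this using 3
    push_cast; module

theorem MX_inv (v : E r) (f : QA F r) : MX v (MX (-v) f) = f := by
  rw [MX_MX, add_neg_cancel, MX_zero]
theorem MX_inv' (v : E r) (f : QA F r) : MX (-v) (MX v f) = f := by
  rw [MX_MX, neg_add_cancel, MX_zero]

/-- If `D X = X' D`, the kernel of `D` is closed under `X`, `X⁻¹`. -/
theorem ker_shift (D : QA F r → QA F r) (v v' : E r) (h : ∀ f, D (MX v f) = MX v' (D f))
    (n : ℤ) (f : QA F r) (hf : D f = 0) : D (MX ((n:ℝ) • v) f) = 0 := by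
  refine shift_closed (fun f => D f = 0) v ?_ ?_ n f hf
  · intro f hf; rw [h, hf, map_zero]
  · intro f hf
    have := h (MX (-v) f)
    rw [MX_inv, hf] at this
    have h3 := congrArg (MX (-v')) this
    rwa [MX_inv', map_zero, eq_comm] at h3

theorem X_shift (D : QA F r → QA F r) (v v' : E r) (h : ∀ f, D (MX v f) = MX v' (D f))
    (n : ℤ) (y : E r) (hf : D (X F r ((n:ℝ) • v + y)) = 0) : D (X F r y) = 0 := by
  have := ker_shift D v v' h (-n) _ hf
  rw [MX_X] at this
  convert this using 3
  push_cast; module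

theorem SO_quad (k : F) (hk : k ≠ 0) (p q : Fin r) (hpq : p ≠ q) (e : ℝ) (he : e = 1 ∨ e = -1)
    (f : QA F r) : SO k p q e (SO k p q e f) = (k - k⁻¹) • SO k p q e f + f := by
  have he2 : e * e = 1 := by rcases he with rfl | rfl <;> norm_num
  induction f using QA_ind with
  | hadd f g hf hg => simp only [map_add, hf, hg]; module
  | hs c f hf => simp only [map_smul, hf]; module
  | hX y =>
    set a : Module.End F (QA F r) := SO k p q e with ha
    have hX1 : ∀ f, a (a (MX (e • ep p) f)) - (k - k⁻¹) • a (MX (e • ep p) f) - MX (e • ep p) f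
        = MX (e • ep p) (a (a f) - (k - k⁻¹) • a f - f) :=
      quad_short a (MX (e • ep p)) (MX (e • ep q)) (k - k⁻¹) (SO_Xp k p q hpq e he)
        (SO_Xq k p q hpq e he)
    suffices h : a (a (X F r y)) - (k - k⁻¹) • a (X F r y) - X F r y = 0 by
      rw [sub_sub, sub_eq_zero] at h; exact h
    refine X_shift (fun f => a (a f) - (k - k⁻¹) • a f - f) _ _ hX1 (-⌊e * (y p - y q)⌋) y ?_
    set z := ((-⌊e * (y p - y q)⌋ : ℤ) : ℝ) • (e • ep p) + y with hz
    have hd : e * (z p - z q) = e * (y p - y q) - ⌊e * (y p - y q)⌋ := by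
      simp only [hz, Pi.add_apply, Pi.smul_apply, ep_same, ep_ne hpq.symm, smul_eq_mul]
      push_cast; linear_combination (-(⌊e * (y p - y q)⌋ : ℝ)) * he2
    have h0 : 0 ≤ e * (z p - z q) := by rw [hd]; linarith [Int.floor_le (e * (y p - y q))]
    have h1 : e * (z p - z q) < 1 := by rw [hd]; linarith [Int.lt_floor_add_one (e * (y p - y q))]
    clear_value z
    change a (a (X F r z)) - (k - k⁻¹) • a (X F r z) - X F r z = 0
    rcases eq_or_lt_of_le h0 with h | h
    · have hzz : z p = z q := by
        have : z p - z q = 0 := by linear_combination -e * h - (z p - z q) * he2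
        linarith
      have hs : sw p q z = z := by
        ext m; simp only [sw_apply]; split_ifs with h1 h2
        · rw [h1, hzz]
        · rw [h2, hzz]
        · rfl
      have := SO_dom k hk p q hpq e he z h0 h1.le
      rw [← ha, hs, ← h] at this
      simp only [muS, if_true] at this
      rw [this, map_smul, this, smul_smul, smul_smul, ← sub_smul, sub_eq_zero]
      rw [show k * k - (k - k⁻¹) * k = 1 by field_simp; ring, one_smul]
    · have e1 := SO_dom k hk p q hpq e he z h0 h1.le
      rw [muS, if_neg h.ne', if_neg h1.ne, one_smul] at e1
      have hsd : e * ((sw p q z) p - (sw p q z) q) = -(e * (z p - z q)) := by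
        simp [sw_apply, hpq]; ring
      have e2 := SO_neg k p q e (sw p q z) (by rw [hsd]; linarith) (by rw [hsd]; linarith)
      have hss : sw p q (sw p q z) = z := by
        ext m; simp only [sw_apply]; split_ifs <;> simp_all
      rw [hss] at e2
      rw [← ha] at e1 e2
      rw [e1, e2]; abel

theorem LO_quad (kk uu c : F) (hk : kk ≠ 0) (hu : uu ≠ 0) (hc : c ≠ 0) (th : ℝ → F)
    (hth : ∀ z, th (z + 1) = (c * c)⁻¹ * th z) (th0 : th 0 = 1)
    (thh : th (1 / 2) = c⁻¹) (thn : ∀ z, th (-z) * th z = 1)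
    (p : Fin r) (e : ℝ) (he : e = 1 ∨ e = -1) (f : QA F r) :
    LO kk uu c th p e (LO kk uu c th p e f) = (kk - kk⁻¹) • LO kk uu c th p e f + f := by
  have he2 : e * e = 1 := by rcases he with rfl | rfl <;> norm_num
  induction f using QA_ind with
  | hadd f g hf hg => simp only [map_add, hf, hg]; module
  | hs c f hf => simp only [map_smul, hf]; module
  | hX y =>
    set b : Module.End F (QA F r) := LO kk uu c th p e with hb
    have hX0 := quad_long b (c • MX (e • ep p)) (c⁻¹ • MX (-(e • ep p))) (kk - kk⁻¹) (uu - uu⁻¹)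
      (fun f => by simp only [LinearMap.smul_apply, map_smul, MX_inv, smul_smul,
          mul_inv_cancel₀ hc, inv_mul_cancel₀ hc, one_smul])
      (fun f => by simp only [LinearMap.smul_apply, map_smul, MX_inv', smul_smul,
          mul_inv_cancel₀ hc, inv_mul_cancel₀ hc, one_smul])
      (LO_X kk uu c hc th hth p e he)
    have hX1 : ∀ f, b (b (MX (e • ep p) f)) - (kk - kk⁻¹) • b (MX (e • ep p) f) - MX (e • ep p) f
        = MX (e • ep p) (b (b f) - (kk - kk⁻¹) • b f - f) := by
      intro f
      have := congrArg (fun w => c⁻¹ • w) (hX0 f)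
      simp only [LinearMap.smul_apply, map_smul, smul_sub, smul_smul] at this
      simp only [inv_mul_cancel₀ hc, one_smul, mul_comm (kk - kk⁻¹) c, inv_mul_cancel_left₀ hc] at this
      rw [this]
    suffices h : b (b (X F r y)) - (kk - kk⁻¹) • b (X F r y) - X F r y = 0 by
      rw [sub_sub, sub_eq_zero] at h; exact h
    have dom : ∀ z : E r, 0 ≤ e * z p → e * z p ≤ 1 / 2 →
        b (b (X F r z)) - (kk - kk⁻¹) • b (X F r z) - X F r z = 0 := by
      intro z h0 h1
      have e1 := LO_dom kk uu c hk hu hc th thh p e he z h0 h1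
      rw [← hb] at e1
      rcases eq_or_lt_of_le h0 with h | h
      · have hzz : z p = 0 := by linear_combination -e * h - z p * he2
        have hs : ng p z = z := by
          ext m; simp only [ng_apply]; split_ifs with h1
          · rw [h1, hzz, neg_zero]
          · rfl
        rw [hs, ← h, th0] at e1
        simp only [muL, if_true, mul_one] at e1
        rw [e1, map_smul, e1, smul_smul, smul_smul, ← sub_smul, sub_eq_zero]
        rw [show kk * kk - (kk - kk⁻¹) * kk = 1 by field_simp; ring, one_smul]
      · have hsd : e * (ng p z) p = -(e * z p) := by simp [ng_apply]
        have e2 := LO_neg kk uu c hc th p e he (ng p z) (by rw [hsd]; linarith) (by rw [hsd]; linarith)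
        have hss : ng p (ng p z) = z := by
          ext m; simp only [ng_apply]; split_ifs <;> simp_all
        rw [hss, hsd, ← hb] at e2
        have hm : muL kk uu (e * z p) * (if -(e * z p) = -1 / 2 then uu else 1) = 1 := by
          rw [muL, if_neg h.ne']
          by_cases h3 : e * z p = 1 / 2
          · rw [if_pos h3, if_pos (by rw [h3]; norm_num), inv_mul_cancel₀ hu]
          · rw [if_neg h3, if_neg (fun h4 => h3 (by linarith)), one_mul]
        have hm2 := thn (e * z p)
        rw [e1, map_smul, e2, smul_add, smul_smul]
        have : muL kk uu (e * z p) * th (e * z p) * ((if -(e * z p) = -1 / 2 then uu else 1) *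
            th (-(e * z p))) = 1 := by linear_combination th (-(e * z p)) * th (e * z p) * hm + hm2
        rw [this]
        module
    refine X_shift (fun f => b (b f) - (kk - kk⁻¹) • b f - f) _ _ hX1 (-⌊e * y p + 1 / 2⌋) y ?_
    set z := ((-⌊e * y p + 1 / 2⌋ : ℤ) : ℝ) • (e • ep p) + y with hz
    have hd : e * z p = e * y p - ⌊e * y p + 1 / 2⌋ := by
      simp only [hz, Pi.add_apply, Pi.smul_apply, ep_same, smul_eq_mul]
      push_cast; linear_combination (-(⌊e * y p + 1 / 2⌋ : ℝ)) * he2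
    have h0 : -1 / 2 ≤ e * z p := by rw [hd]; linarith [Int.floor_le (e * y p + 1 / 2)]
    have h1 : e * z p ≤ 1 / 2 := by rw [hd]; linarith [Int.lt_floor_add_one (e * y p + 1 / 2)]
    clear_value z
    change b (b (X F r z)) - (kk - kk⁻¹) • b (X F r z) - X F r z = 0
    by_cases hs : 0 ≤ e * z p
    · exact dom z hs h1
    · have hsd : e * (ng p z) p = -(e * z p) := by simp [ng_apply]
      have hss : ng p (ng p z) = z := by
        ext m; simp only [ng_apply]; split_ifs <;> simp_all
      have e1 := LO_dom kk uu c hk hu hc th thh p e he (ng p z) (by rw [hsd]; linarith)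
        (by rw [hsd]; linarith)
      have e2 := congrArg b (dom (ng p z) (by rw [hsd]; linarith) (by rw [hsd]; linarith))
      have hne : muL kk uu (e * (ng p z) p) * th (e * (ng p z) p) ≠ 0 :=
        mul_ne_zero (muL_ne _ _ hk hu _) (right_ne_zero_of_mul_eq_one (thn _))
      rw [hss, ← hb] at e1
      simp only [map_sub, map_smul, e1, map_zero, ← smul_sub] at e2
      rw [smul_comm, ← smul_sub, ← smul_sub] at e2
      exact (smul_eq_zero.mp e2).resolve_left hne

end Dom


/-! ### Braid relations -/

section Braid

variable {F r}

theorem X_shift' (D : QA F r → QA F r) (v v' : E r) (c : F) (hc : c ≠ 0)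
    (h : ∀ f, D (MX v f) = c • MX v' (D f))
    (n : ℤ) (y : E r) (hf : D (X F r ((n:ℝ) • v + y)) = 0) : D (X F r y) = 0 := by
  have := shift_closed (fun f => D f = 0) v ?_ ?_ (-n) _ hf
  · rw [MX_X] at this
    convert this using 3
    push_cast; module
  · intro f hf; rw [h, hf, map_zero, smul_zero]
  · intro f hf
    have := h (MX (-v) f)
    rw [MX_inv, hf] at this
    have h4 := (smul_eq_zero.mp this.symm).resolve_left hc
    have h3 := congrArg (MX (-v')) h4
    rwa [MX_inv', map_zero] at h3

theorem sort3 (K : ℝ → ℝ → ℝ → Prop)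
    (h : ∀ x y z, z ≤ y → y ≤ x → x ≤ z + 1 → K x y z)
    (m1 : ∀ x y z, K x y z → y ≤ x → x ≤ y + 1 → K y x z)
    (m2 : ∀ x y z, K x y z → z ≤ y → y ≤ z + 1 → K x z y)
    (x y z : ℝ) (h1 : y ≤ x) (h2 : x ≤ y + 1) (h3 : y ≤ z) (h4 : z ≤ y + 1) : K x y z := by
  rcases le_total x z with h5 | h5
  · exact m2 _ _ _ (m1 _ _ _ (h z x y h1 h5 h4) h5 (by linarith)) h3 h4
  · exact m2 _ _ _ (h x z y h3 h5 h2) h3 h4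

theorem sort2 (K : ℝ → ℝ → Prop)
    (h : ∀ x y, 0 ≤ y → y ≤ x → x ≤ 1 / 2 → K x y)
    (m1 : ∀ x y, K x y → y ≤ x → x ≤ y + 1 → K y x)
    (m2 : ∀ x y, K x y → 0 ≤ y → y ≤ 1 / 2 → K x (-y))
    (x y : ℝ) (h1 : -1/2 ≤ x) (h2 : x ≤ 1/2) (h3 : -1/2 ≤ y) (h4 : y ≤ 1/2) : K x y := by
  have pp : ∀ x y, 0 ≤ x → x ≤ 1/2 → 0 ≤ y → y ≤ 1/2 → K x y := by
    intro x y h1 h2 h3 h4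
    rcases le_total y x with h5 | h5
    · exact h _ _ h3 h5 h2
    · exact m1 _ _ (h _ _ h1 h5 h4) h5 (by linarith)
  have pa : ∀ x y, 0 ≤ x → x ≤ 1/2 → -1/2 ≤ y → y ≤ 1/2 → K x y := by
    intro x y h1 h2 h3 h4
    rcases le_total 0 y with h5 | h5
    · exact pp _ _ h1 h2 h5 h4
    · have := m2 _ _ (pp x (-y) h1 h2 (by linarith) (by linarith)) (by linarith) (by linarith)
      rwa [neg_neg] at this
  have ap : ∀ x y, -1/2 ≤ x → x ≤ 1/2 → 0 ≤ y → y ≤ 1/2 → K x y := by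
    intro x y h1 h2 h3 h4
    rcases le_total 0 x with h5 | h5
    · exact pp _ _ h5 h2 h3 h4
    · exact m1 _ _ (pa y x h3 h4 h1 h2) (by linarith) (by linarith)
  rcases le_total 0 y with h5 | h5
  · exact ap _ _ h1 h2 h5 h4
  · have := m2 _ _ (ap x (-y) h1 h2 (by linarith) (by linarith)) (by linarith) (by linarith)
    rwa [neg_neg] at this

theorem SO_braid3 (k : F) (hk : k ≠ 0) (p q s : Fin r) (hpq : p ≠ q) (hqs : q ≠ s) (hps : p ≠ s)
    (f : QA F r) :
    SO k p q 1 (SO k q s 1 (SO k p q 1 f)) = SO k q s 1 (SO k p q 1 (SO k q s 1 f)) := by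
  induction f using QA_ind with
  | hadd f g hf hg => simp only [map_add, hf, hg]
  | hs c f hf => simp only [map_smul, hf]
  | hX w =>
    obtain ⟨a, ha⟩ : ∃ a, a = (SO k p q 1 : Module.End F (QA F r)) := ⟨_, rfl⟩
    obtain ⟨b, hb⟩ : ∃ b, b = (SO k q s 1 : Module.End F (QA F r)) := ⟨_, rfl⟩
    rw [← ha, ← hb, ← sub_eq_zero]
    have qa : ∀ f, a (a f) = (k - k⁻¹) • a f + f := by
      rw [ha]; exact SO_quad k hk p q hpq 1 (Or.inl rfl)
    have qb : ∀ f, b (b f) = (k - k⁻¹) • b f + f := by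
      rw [hb]; exact SO_quad k hk q s hqs 1 (Or.inl rfl)
    have hX := braid3_X a b (MX ((1:ℝ) • ep p)) (MX ((1:ℝ) • ep q)) (MX ((1:ℝ) • ep s)) (k - k⁻¹) qa qb
      (by rw [ha]; exact SO_Xp k p q hpq 1 (Or.inl rfl))
      (by rw [ha]; exact SO_Xq k p q hpq 1 (Or.inl rfl))
      (by rw [ha]; exact SO_off k p q 1 _ (by simp [ep_ne hps]) (by simp [ep_ne hqs]))
      (by rw [hb]; exact SO_off k q s 1 _ (by simp [ep_ne hpq.symm]) (by simp [ep_ne hps.symm]))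
      (by rw [hb]; exact SO_Xp k q s hqs 1 (Or.inl rfl))
      (by rw [hb]; exact SO_Xq k q s hqs 1 (Or.inl rfl))
    have hTa := braid3_T a b (k - k⁻¹) qa qb
    have hTb := braid3_T b a (k - k⁻¹) qb qa
    refine X_shift (fun f => a (b (a f)) - b (a (b f))) _ _ (fun f => (hX f).1) (-⌊w p - w q⌋) w ?_
    refine X_shift (fun f => a (b (a f)) - b (a (b f))) _ _ (fun f => (hX f).2) (-⌊w s - w q⌋) _ ?_
    obtain ⟨P, hP⟩ : ∃ P : ℝ → ℝ → ℝ → E r, P = fun x y z m =>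
      if m = p then x else if m = q then y else if m = s then z else w m := ⟨_, rfl⟩
    have aP : ∀ x y z, y ≤ x → x ≤ y + 1 → a (X F r (P x y z)) = muS k (x - y) • X F r (P y x z) := by
      intro x y z h1 h2
      have e1 : P x y z p = x := by simp [hP]
      have e2 : P x y z q = y := by simp [hP, hpq.symm]
      have e3 : sw p q (P x y z) = P y x z := by
        ext m; rw [sw_apply, e1, e2]; simp only [hP]
        by_cases h : m = q
        · simp [h, hpq.symm]
        · by_cases h' : m = p <;> simp [h, h', hpq]
      rw [ha, SO_dom k hk p q hpq 1 (Or.inl rfl) _ (by rw [e1, e2]; linarith)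
        (by rw [e1, e2]; linarith), e3, e1, e2, one_mul]
    have bP : ∀ x y z, z ≤ y → y ≤ z + 1 → b (X F r (P x y z)) = muS k (y - z) • X F r (P x z y) := by
      intro x y z h1 h2
      have e1 : P x y z q = y := by simp [hP, hpq.symm]
      have e2 : P x y z s = z := by simp [hP, hps.symm, hqs.symm]
      have e3 : sw q s (P x y z) = P x z y := by
        ext m; rw [sw_apply, e1, e2]; simp only [hP]
        by_cases h : m = s
        · simp [h, hps.symm, hqs.symm]
        · by_cases h' : m = q
          · simp [h, h', hpq.symm, hqs]
          · simp [h, h']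
      rw [hb, SO_dom k hk q s hqs 1 (Or.inl rfl) _ (by rw [e1, e2]; linarith)
        (by rw [e1, e2]; linarith), e3, e1, e2, one_mul]
    have main := sort3 (fun x y z => a (b (a (X F r (P x y z)))) - b (a (b (X F r (P x y z)))) = 0)
      ?_ ?_ ?_ (w p - ⌊w p - w q⌋) (w q) (w s - ⌊w s - w q⌋)
      (by linarith [Int.floor_le (w p - w q)]) (by linarith [Int.lt_floor_add_one (w p - w q)])
      (by linarith [Int.floor_le (w s - w q)]) (by linarith [Int.lt_floor_add_one (w s - w q)])
    · convert main using 6 <;>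
      · ext m
        simp only [hP, Pi.add_apply, Pi.smul_apply, smul_eq_mul, one_mul]
        by_cases h1 : m = p
        · subst h1; simp [ep_same, ep_ne hps]; ring
        · by_cases h2 : m = q
          · subst h2; simp [ep_ne h1, ep_ne hqs, h1]
          · by_cases h3 : m = s
            · subst h3; simp [ep_same, ep_ne h1, h1, h2]; ring
            · simp [ep_ne h1, ep_ne h3, h1, h2, h3]
    · intro x y z h1 h2 h3
      rw [aP x y z h2 (by linarith), bP x y z h1 (by linarith), map_smul, map_smul, map_smul, map_smul,
        bP y x z (by linarith) h3, aP x z y (by linarith) h3, map_smul, map_smul,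
        aP y z x h1 (by linarith), bP z x y h2 (by linarith)]
      module
    · intro x y z h h1 h2
      have := hTa (X F r (P x y z))
      rw [h, map_zero, smul_zero, sub_zero, aP x y z h1 h2] at this
      simp only [map_smul] at this
      rw [← smul_sub] at this
      exact (smul_eq_zero.mp this).resolve_left (muS_ne k hk _)
    · intro x y z h h1 h2
      have := hTb (X F r (P x y z))
      rw [← neg_sub (a (b (a (X F r (P x y z))))), h, neg_zero, map_zero, smul_zero, sub_zero, bP x y z h1 h2] at this
      simp only [map_smul] at this
      rw [← smul_sub] at this
      have := (smul_eq_zero.mp this).resolve_left (muS_ne k hk _)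
      rw [← neg_sub, this, neg_zero]

theorem SO_LO_braid4 (k : F) (hk : k ≠ 0) (p q : Fin r) (hpq : p ≠ q)
    (kk uu c : F) (hkk : kk ≠ 0) (hu : uu ≠ 0) (hc : c ≠ 0) (th : ℝ → F)
    (hth : ∀ z, th (z + 1) = (c * c)⁻¹ * th z) (th0 : th 0 = 1)
    (thh : th (1 / 2) = c⁻¹) (thn : ∀ z, th (-z) * th z = 1)
    (e : ℝ) (he : e = 1 ∨ e = -1) (f : QA F r) :
    SO k p q e (LO kk uu c th q e (SO k p q e (LO kk uu c th q e f))) =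
      LO kk uu c th q e (SO k p q e (LO kk uu c th q e (SO k p q e f))) := by
  have he2 : e * e = 1 := by rcases he with rfl | rfl <;> norm_num
  induction f using QA_ind with
  | hadd f g hf hg => simp only [map_add, hf, hg]
  | hs c f hf => simp only [map_smul, hf]
  | hX w =>
    obtain ⟨a, ha⟩ : ∃ a, a = (SO k p q e : Module.End F (QA F r)) := ⟨_, rfl⟩
    obtain ⟨b, hb⟩ : ∃ b, b = (LO kk uu c th q e : Module.End F (QA F r)) := ⟨_, rfl⟩
    rw [← ha, ← hb, ← sub_eq_zero]
    have qa : ∀ f, a (a f) = (k - k⁻¹) • a f + f := by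
      rw [ha]; exact SO_quad k hk p q hpq e he
    have qb : ∀ f, b (b f) = (kk - kk⁻¹) • b f + f := by
      rw [hb]; exact LO_quad kk uu c hkk hu hc th hth th0 thh thn q e he
    have i1 : ∀ (v : E r) f, (c • MX v : Module.End F (QA F r)) ((c⁻¹ • MX (-v) : Module.End F (QA F r)) f) = f := by
      intro v f; simp only [LinearMap.smul_apply, map_smul, MX_inv, smul_smul,
          mul_inv_cancel₀ hc, inv_mul_cancel₀ hc, one_smul]
    have i2 : ∀ (v : E r) f, (c⁻¹ • MX (-v) : Module.End F (QA F r)) ((c • MX v : Module.End F (QA F r)) f) = f := by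
      intro v f; simp only [LinearMap.smul_apply, map_smul, MX_inv', smul_smul,
          mul_inv_cancel₀ hc, inv_mul_cancel₀ hc, one_smul]
    have hX := braid4_X a b (c • MX (e • ep p)) (c • MX (e • ep q)) (c⁻¹ • MX (-(e • ep p)))
      (c⁻¹ • MX (-(e • ep q))) (k - k⁻¹) (kk - kk⁻¹) (uu - uu⁻¹) qa qb (i1 _) (i2 _) (i1 _) (i2 _)
      (by intro f; rw [ha]; simp only [LinearMap.smul_apply, map_smul]
          rw [SO_Xp k p q hpq e he]; module)
      (by intro f; rw [ha]; simp only [LinearMap.smul_apply, map_smul]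
          rw [SO_Xq k p q hpq e he]; module)
      (by intro f; rw [hb]; simp only [LinearMap.smul_apply, map_smul]
          rw [LO_off kk uu c th q e _ (by simp [ep_ne hpq.symm])])
      (by rw [hb]; exact LO_X kk uu c hc th hth q e he)
    have hT := braid4_T a b (k - k⁻¹) (kk - kk⁻¹) qa qb
    have sc : ∀ u v : QA F r, c • u = c⁻¹ • v → u = (c⁻¹ * c⁻¹) • v := by
      intro u v h
      have := congrArg (fun z => c⁻¹ • z) h
      simpa only [smul_smul, inv_mul_cancel₀ hc, one_smul] using this
    have hne : c⁻¹ * c⁻¹ ≠ 0 := by simp [hc]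
    refine X_shift' (fun f => a (b (a (b f))) - b (a (b (a f)))) _ _ _ hne
      (fun f => sc _ _ (by simpa only [LinearMap.smul_apply, map_smul, ← smul_sub] using (hX f).1))
      (-⌊e * w p + 1/2⌋) w ?_
    refine X_shift' (fun f => a (b (a (b f))) - b (a (b (a f)))) _ _ _ hne
      (fun f => sc _ _ (by simpa only [LinearMap.smul_apply, map_smul, ← smul_sub] using (hX f).2))
      (-⌊e * w q + 1/2⌋) _ ?_
    obtain ⟨P, hP⟩ : ∃ P : ℝ → ℝ → E r, P = fun x y m =>
      if m = p then e * x else if m = q then e * y else w m := ⟨_, rfl⟩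
    have aP : ∀ x y, y ≤ x → x ≤ y + 1 → a (X F r (P x y)) = muS k (x - y) • X F r (P y x) := by
      intro x y h1 h2
      have e1 : P x y p = e * x := by simp [hP]
      have e2 : P x y q = e * y := by simp [hP, hpq.symm]
      have e3 : sw p q (P x y) = P y x := by
        ext m; rw [sw_apply, e1, e2]; simp only [hP]
        by_cases h : m = q
        · simp [h, hpq.symm]
        · by_cases h' : m = p <;> simp [h, h', hpq]
      have e4 : e * (e * x - e * y) = x - y := by linear_combination (x - y) * he2
      rw [ha, SO_dom k hk p q hpq e he _ (by rw [e1, e2, e4]; linarith)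
        (by rw [e1, e2, e4]; linarith), e3, e1, e2, e4]
    have bP : ∀ x y, 0 ≤ y → y ≤ 1 / 2 →
        b (X F r (P x y)) = (muL kk uu y * th y) • X F r (P x (-y)) := by
      intro x y h1 h2
      have e2 : P x y q = e * y := by simp [hP, hpq.symm]
      have e3 : ng q (P x y) = P x (-y) := by
        ext m; rw [ng_apply, e2]; simp only [hP]
        by_cases h : m = q
        · simp [h, hpq.symm]
        · simp [h]
      have e4 : e * (e * y) = y := by linear_combination y * he2
      rw [hb, LO_dom kk uu c hkk hu hc th thh q e he _ (by rw [e2, e4]; linarith)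
        (by rw [e2, e4]; linarith), e3, e2, e4]
    have main := sort2 (fun x y => a (b (a (b (X F r (P x y))))) - b (a (b (a (X F r (P x y))))) = 0)
      ?_ ?_ ?_ (e * w p - ⌊e * w p + 1 / 2⌋) (e * w q - ⌊e * w q + 1 / 2⌋)
      (by linarith [Int.floor_le (e * w p + 1/2)])
      (by linarith [Int.lt_floor_add_one (e * w p + 1/2)])
      (by linarith [Int.floor_le (e * w q + 1/2)]) (by linarith [Int.lt_floor_add_one (e * w q + 1/2)])
    · convert main using 7 <;>
      · ext m
        simp only [hP, Pi.add_apply, Pi.smul_apply, smul_eq_mul]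
        by_cases h1 : m = p
        · subst h1; simp [ep_same, ep_ne hpq]; linear_combination (- w m) * he2
        · by_cases h2 : m = q
          · subst h2; simp [ep_ne h1, ep_same, h1]; linear_combination (- w m) * he2
          · simp [ep_ne h1, ep_ne h2, h1, h2]
    · intro x y h1 h2 h3
      rw [aP x y h2 (by linarith), bP x y h1 (by linarith)]
      simp only [map_smul]
      rw [aP x (-y) (by linarith) (by linarith), bP y x (by linarith) h3]
      simp only [map_smul]
      rw [aP y (-x) (by linarith) (by linarith), bP (-y) x (by linarith) (by linarith)]
      simp only [map_smul]
      rw [aP (-y) (-x) (by linarith) (by linarith), bP (-x) y (by linarith) (by linarith)]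
      rw [show -y - -x = x - y by ring, show x - -y = y - -x by ring]
      module
    · intro x y h h1 h2
      have := (hT (X F r (P x y))).1
      rw [h, map_zero, smul_zero, sub_zero, aP x y h1 h2] at this
      simp only [map_smul] at this
      rw [← smul_sub] at this
      exact (smul_eq_zero.mp this).resolve_left (muS_ne k hk _)
    · intro x y h h1 h2
      have := (hT (X F r (P x y))).2
      rw [h, map_zero, smul_zero, sub_zero, bP x y h1 h2] at this
      simp only [map_smul] at this
      rw [← smul_sub] at this
      exact (smul_eq_zero.mp this).resolve_left
        (mul_ne_zero (muL_ne _ _ hkk hu _) (right_ne_zero_of_mul_eq_one (thn _)))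

end Braid


/-! ### Commutation of operators with disjoint supports -/

section Disj

variable {F r}

theorem geomS_pass (b : Module.End F (QA F r)) (c : F) (v : E r) (m : ℤ)
    (h : ∀ (n : ℝ) f, b (MX (n • v) f) = MX (n • v) (b f)) (f : QA F r) :
    b (geomS F r c v m * f) = geomS F r c v m * b f := by
  simp only [MX_apply] at h
  unfold geomS
  split_ifs
  · simp only [Finset.sum_mul, map_sum, smul_mul_assoc, map_smul, h]
  · simp only [Finset.sum_mul, map_sum, smul_mul_assoc, map_smul, h, neg_mul, map_neg]

theorem comm_gen (a b : Module.End F (QA F r)) (m m' : E r → F) (s s' : E r → E r) (P P' : E r → QA F r)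
    (ha : ∀ y, a (X F r y) = m y • X F r (s y) + P y * X F r y)
    (hb : ∀ y, b (X F r y) = m' y • X F r (s' y) + P' y * X F r y)
    (hs : ∀ y, s (s' y) = s' (s y)) (hm : ∀ y, m (s' y) = m y) (hm' : ∀ y, m' (s y) = m' y)
    (hP : ∀ y, P (s' y) = P y) (hP' : ∀ y, P' (s y) = P' y)
    (hbP : ∀ y f, b (P y * f) = P y * b f) (haP : ∀ y f, a (P' y * f) = P' y * a f)
    (f : QA F r) : a (b f) = b (a f) := by
  induction f using QA_ind with
  | hadd f g hf hg => simp only [map_add, hf, hg]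
  | hs c f hf => simp only [map_smul, hf]
  | hX y =>
    rw [hb, ha]
    simp only [map_add, map_smul, haP, hbP]
    rw [ha, hb, ha, hb, hs, hm, hm', hP, hP']
    simp only [smul_add, mul_add, mul_smul_comm, mul_left_comm (P' y) (P y)]
    module

/-- coefficient for the short operator -/
def SP (k : F) (p q : Fin r) (e : ℝ) (y : E r) : QA F r :=
  (k - k⁻¹) • (geomS F r 1 (e • (ep p - ep q)) (-⌊e * (y p - y q)⌋))

/-- coefficient for the long operator -/
def LP (kk uu c : F) (p : Fin r) (e : ℝ) (y : E r) : QA F r :=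
  (kk - kk⁻¹) • (geomS F r (c * c) ((2 * e) • ep p) (-floorE (2 * e * y p) / 2))
    + (uu - uu⁻¹) • ((c • X F r (e • ep p)) *
        geomS F r (c * c) ((2 * e) • ep p) ((-floorO (2 * e * y p) - 1) / 2))

theorem SO_form (k : F) (p q : Fin r) (e : ℝ) (y : E r) :
    SO k p q e (X F r y) = k ^ chiZ (e * (y p - y q)) • X F r (sw p q y) + SP k p q e y * X F r y := by
  simp only [SO, mkOp_X, SEl, SP, smul_mul_assoc]

theorem LO_form (kk uu c : F) (th : ℝ → F) (p : Fin r) (e : ℝ) (y : E r) :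
    LO kk uu c th p e (X F r y) =
      (kk ^ chiE (2 * y p) * uu ^ chiO (2 * y p) * th (e * y p)) • X F r (ng p y)
        + LP kk uu c p e y * X F r y := by
  simp only [LO, mkOp_X, LEl, LP, smul_mul_assoc, add_mul, add_assoc]

theorem SP_pass (b : Module.End F (QA F r)) (k : F) (p q : Fin r) (e : ℝ)
    (h : ∀ (v : E r) f, (∀ m, m ≠ p → m ≠ q → v m = 0) → b (MX v f) = MX v (b f)) (y : E r) (f : QA F r) :
    b (SP k p q e y * f) = SP k p q e y * b f := by
  simp only [SP, smul_mul_assoc, map_smul]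
  rw [geomS_pass]
  intro n f
  apply h
  intro m h1 h2
  simp [ep_ne h1, ep_ne h2]

theorem LP_pass (b : Module.End F (QA F r)) (kk uu c : F) (p : Fin r) (e : ℝ)
    (h : ∀ (v : E r) f, (∀ m, m ≠ p → v m = 0) → b (MX v f) = MX v (b f)) (y : E r) (f : QA F r) :
    b (LP kk uu c p e y * f) = LP kk uu c p e y * b f := by
  have h1 : ∀ (n : ℝ) f, b (MX (n • ((2 * e) • ep p)) f) = MX (n • ((2 * e) • ep p)) (b f) := by
    intro n f
    apply h
    intro m h1
    simp [ep_ne h1]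
  have h2 : ∀ f, b (X F r (e • ep p) * f) = X F r (e • ep p) * b f := by
    intro f
    apply h
    intro m h1
    simp [ep_ne h1]
  simp only [LP, smul_mul_assoc, map_smul, add_mul, map_add, mul_assoc]
  rw [geomS_pass _ _ _ _ h1, h2, geomS_pass _ _ _ _ h1]

theorem SO_SO_comm (k k' : F) (p q p' q' : Fin r) (e e' : ℝ) (h1 : p ≠ p') (h2 : p ≠ q')
    (h3 : q ≠ p') (h4 : q ≠ q') (f : QA F r) :
    SO k p q e (SO k' p' q' e' f) = SO k' p' q' e' (SO k p q e f) := by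
  refine comm_gen _ _ _ _ _ _ _ _ (SO_form k p q e) (SO_form k' p' q' e') ?_ ?_ ?_ ?_ ?_ ?_ ?_ f
  · intro y
    ext m
    simp only [sw_apply]
    have h1' := h1.symm
    have h2' := h2.symm
    have h3' := h3.symm
    have h4' := h4.symm
    by_cases m1 : m = p <;> by_cases m2 : m = q <;> by_cases m3 : m = p' <;> by_cases m4 : m = q' <;>
      simp_all
  · intro y; simp [sw_apply, h1, h2, h3, h4]
  · intro y; simp [sw_apply, h1.symm, h2.symm, h3.symm, h4.symm]
  · intro y; simp [SP, sw_apply, h1, h2, h3, h4]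
  · intro y; simp [SP, sw_apply, h1.symm, h2.symm, h3.symm, h4.symm]
  · exact SP_pass _ _ _ _ _ fun v f hv => SO_off _ _ _ _ _ (hv _ h1.symm h3.symm) (hv _ h2.symm h4.symm) _
  · exact SP_pass _ _ _ _ _ fun v f hv => SO_off _ _ _ _ _ (hv _ h1 h2) (hv _ h3 h4) _

theorem SO_LO_comm (k kk uu c : F) (th : ℝ → F) (p q p' : Fin r) (e e' : ℝ) (h1 : p ≠ p')
    (h3 : q ≠ p') (f : QA F r) :
    SO k p q e (LO kk uu c th p' e' f) = LO kk uu c th p' e' (SO k p q e f) := by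
  refine comm_gen _ _ _ _ _ _ _ _ (SO_form k p q e) (LO_form kk uu c th p' e') ?_ ?_ ?_ ?_ ?_ ?_ ?_ f
  · intro y
    ext m
    simp only [sw_apply, ng_apply]
    by_cases m1 : m = p <;> by_cases m2 : m = q <;> by_cases m3 : m = p' <;>
      simp_all
  · intro y; simp [ng_apply, h1, h3]
  · intro y; simp [sw_apply, h1.symm, h3.symm]
  · intro y; simp [SP, ng_apply, h1, h3]
  · intro y; simp [LP, sw_apply, h1.symm, h3.symm]
  · exact SP_pass _ _ _ _ _ fun v f hv => LO_off _ _ _ _ _ _ _ (hv _ h1.symm h3.symm) _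
  · exact LP_pass _ _ _ _ _ _ fun v f hv => SO_off _ _ _ _ _ (hv _ h1) (hv _ h3) _

theorem LO_LO_comm (k u d kk uu c : F) (th th' : ℝ → F) (p p' : Fin r) (e e' : ℝ) (h1 : p ≠ p')
    (f : QA F r) :
    LO k u d th p e (LO kk uu c th' p' e' f) = LO kk uu c th' p' e' (LO k u d th p e f) := by
  refine comm_gen _ _ _ _ _ _ _ _ (LO_form k u d th p e) (LO_form kk uu c th' p' e') ?_ ?_ ?_ ?_ ?_ ?_ ?_ f
  · intro y
    ext m
    simp only [ng_apply]
    by_cases m1 : m = p <;> by_cases m3 : m = p' <;>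
      simp_all
  · intro y; simp [ng_apply, h1]
  · intro y; simp [ng_apply, h1.symm]
  · intro y; simp [LP, ng_apply, h1]
  · intro y; simp [LP, ng_apply, h1.symm]
  · exact LP_pass _ _ _ _ _ _ fun v f hv => LO_off _ _ _ _ _ _ _ (hv _ h1.symm) _
  · exact LP_pass _ _ _ _ _ _ fun v f hv => LO_off _ _ _ _ _ _ _ (hv _ h1) _

end Disj


/-! ### Comparison with the operators of the definitions -/

section Compare

variable {F r}

theorem cd_eq (y : E r) (p : Fin r) (i : ℕ) (h : (p : ℕ) + 1 = i) : cd r y i = y p := by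
  subst h
  unfold cd
  rw [Finset.sum_eq_single p]
  · simp
  · intro m _ hm
    rw [if_neg]
    intro h; apply hm; ext; omega
  · simp

theorem epsV_eq (p : Fin r) (i : ℕ) (h : (p : ℕ) + 1 = i) : epsV r i = ep p := by
  subst h
  ext m
  unfold epsV ep
  by_cases hm : m = p
  · subst hm; simp
  · rw [if_neg, Pi.single_eq_of_ne hm]
    intro h; apply hm; ext; omega

theorem tcU_eq (t : Fin r → Fˣ) (p : Fin r) (i : ℕ) (h : (p : ℕ) + 1 = i) : tcU F r t i = t p := by
  subst h
  unfold tcU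
  rw [Finset.prod_eq_single p]
  · simp
  · intro m _ hm
    rw [if_neg]
    intro h; apply hm; ext; omega
  · simp

theorem sW_sw (p q : Fin r) (hpq : (p : ℕ) + 1 = q) (y : E r) : sW r (p + 1) y = sw p q y := by
  ext m
  unfold sW
  rw [if_neg (by have := q.2; omega), cd_eq y q _ (by omega), cd_eq y p _ rfl, sw_apply]
  by_cases h1 : m = p
  · subst h1; rw [if_pos rfl, if_neg (by intro h; rw [h] at hpq; omega), if_pos rfl]
  · by_cases h2 : m = q
    · subst h2; rw [if_neg (by omega), if_pos (by omega), if_pos rfl]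
    · rw [if_neg (by intro h; apply h1; ext; omega), if_neg (by intro h; apply h2; ext; omega),
        if_neg h2, if_neg h1]

theorem sW_ng (p : Fin r) (hp : (p : ℕ) + 1 = r) (y : E r) : sW r r y = ng p y := by
  ext m
  unfold sW
  rw [if_pos rfl, ng_apply]
  by_cases h1 : m = p
  · subst h1; rw [if_pos hp, if_pos rfl]
  · rw [if_neg (by intro h; apply h1; ext; omega), if_neg h1]

theorem sEps1_ng (p : Fin r) (hp : (p : ℕ) = 0) (y : E r) : sEps1 r y = ng p y := by
  ext m
  unfold sEps1
  rw [ng_apply]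
  by_cases h1 : m = p
  · subst h1; rw [if_pos hp, if_pos rfl]
  · rw [if_neg (by intro h; apply h1; ext; omega), if_neg h1]

theorem Top_SO (k kr ur : F) (p q : Fin r) (hpq : (p : ℕ) + 1 = q) :
    Top F r k kr ur (p + 1) = SO k p q 1 := by
  unfold Top SO
  congr 1
  funext y
  unfold Tel SEl nablaIel
  rw [if_neg (by have := q.2; omega), cd_eq y p _ rfl, cd_eq y q _ (by omega), sW_sw p q hpq,
    epsV_eq p _ rfl, epsV_eq q _ (by omega), one_mul, one_smul]

theorem Top_LO (k kr ur : F) (p : Fin r) (hp : (p : ℕ) + 1 = r) :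
    Top F r k kr ur r = LO kr ur 1 (fun _ => 1) p 1 := by
  unfold Top LO
  congr 1
  funext y
  unfold Tel LEl nablaReEl nablaRoEl
  rw [if_pos rfl, cd_eq y p _ hp, sW_ng p hp, epsV_eq p _ hp]
  simp only [mul_one, one_smul]

theorem T0el_LEl (qh : Fˣ) (k0 u0 : F) (t : Fin r → Fˣ) (p : Fin r) (hp : (p : ℕ) = 0)
    (th : ℝ → F) (y : E r)
    (h : ((torusAct F r qh (gfun r y) t p : Fˣ) : F) = th (-1 * y p)) :
    T0el F r qh k0 u0 t y = LEl k0 u0 (qh : F) th p (-1) y := by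
  unfold T0el LEl nabla0eEl nabla0oEl
  rw [cd_eq y p _ (by omega), tcU_eq _ p _ (by omega), sEps1_ng p hp, epsV_eq p _ (by omega), h]
  simp only [mul_neg, mul_one]

theorem SO_symm (k : F) (p q : Fin r) : SO k p q (-1) = SO k q p 1 := by
  unfold SO
  congr 1
  funext y
  unfold SEl
  have h : sw p q y = sw q p y := by
    ext m; simp only [sw_apply]; by_cases h1 : m = p <;> by_cases h2 : m = q <;> simp_all
  have h2 : (-1 : ℝ) • (ep p - ep q : E r) = (1 : ℝ) • (ep q - ep p) := by module
  rw [h, h2, show -1 * (y p - y q) = 1 * (y q - y p) by ring]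

end Compare

/-! ### The global operators -/

section Glob
variable {F r}

/-- The global version of the generators. -/
def TG (qh k0 u0 k kr ur : F) (th : ℝ → F) (hr : 2 ≤ r) (j : ℕ) : Module.End F (QA F r) :=
  if j = 0 then LO k0 u0 qh th ⟨0, by omega⟩ (-1) else Top F r k kr ur j

theorem TG_zero (qh k0 u0 k kr ur : F) (th : ℝ → F) (hr : 2 ≤ r) :
    TG qh k0 u0 k kr ur th hr 0 = LO k0 u0 qh th ⟨0, by omega⟩ (-1) := if_pos rfl

theorem TG_SO (qh k0 u0 k kr ur : F) (th : ℝ → F) (hr : 2 ≤ r) (j : ℕ) (h0 : 1 ≤ j) (h1 : j < r) :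
    TG qh k0 u0 k kr ur th hr j = SO k ⟨j - 1, by omega⟩ ⟨j, h1⟩ 1 := by
  rw [TG, if_neg (by omega), ← Top_SO k kr ur ⟨j - 1, by omega⟩ ⟨j, h1⟩ (by simp <;> omega)]
  congr 1
  simp; omega

theorem TG_LO (qh k0 u0 k kr ur : F) (th : ℝ → F) (hr : 2 ≤ r) :
    TG qh k0 u0 k kr ur th hr r = LO kr ur 1 (fun _ => 1) ⟨r - 1, by omega⟩ 1 := by
  rw [TG, if_neg (by omega), Top_LO k kr ur ⟨r - 1, by omega⟩ (by simp <;> omega)]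

/-- Conditions on the function `th`. -/
structure ThOK (qh : F) (th : ℝ → F) : Prop where
  hth : ∀ z, th (z + 1) = (qh * qh)⁻¹ * th z
  th0 : th 0 = 1
  thh : th (1 / 2) = qh⁻¹
  thn : ∀ z, th (-z) * th z = 1

theorem thOK_one : ThOK (1 : F) (fun _ => 1) := by constructor <;> simp

variable (qh k0 u0 k kr ur : Fˣ) (th : ℝ → F) (hr : 2 ≤ r)

theorem TG_quad (hth : ThOK (qh : F) th) (j : ℕ) (hj : j ≤ r) (f : QA F r) :
    TG (qh : F) k0 u0 k kr ur th hr j (TG (qh : F) k0 u0 k kr ur th hr j f) =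
      (kpar F r k0 k kr j - (kpar F r k0 k kr j)⁻¹) • TG (qh : F) k0 u0 k kr ur th hr j f + f := by
  rcases Nat.eq_zero_or_pos j with rfl | h
  · rw [TG_zero, kpar, if_pos rfl]
    exact LO_quad _ _ _ k0.ne_zero u0.ne_zero qh.ne_zero th hth.hth hth.th0 hth.thh hth.thn _ _
      (Or.inr rfl) f
  rcases Nat.lt_or_ge j r with h1 | h1
  · rw [TG_SO _ _ _ _ _ _ _ _ j h h1, kpar, if_neg (by omega), if_neg (by omega)]
    exact SO_quad _ k.ne_zero _ _ (by simp <;> omega) _ (Or.inl rfl) f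
  · obtain rfl : j = r := by omega
    rw [TG_LO, kpar, if_neg (by omega), if_pos rfl]
    exact LO_quad _ _ _ kr.ne_zero ur.ne_zero one_ne_zero _ thOK_one.hth thOK_one.th0
      thOK_one.thh thOK_one.thn _ _ (Or.inl rfl) f

theorem TG_far (i j : ℕ) (hij : i + 2 ≤ j) (hj : j ≤ r) :
    Commute (TG (qh : F) k0 u0 k kr ur th hr i) (TG (qh : F) k0 u0 k kr ur th hr j) := by
  apply LinearMap.ext
  intro f
  change TG (qh : F) k0 u0 k kr ur th hr i (TG (qh : F) k0 u0 k kr ur th hr j f) =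
    TG (qh : F) k0 u0 k kr ur th hr j (TG (qh : F) k0 u0 k kr ur th hr i f)
  rcases Nat.eq_zero_or_pos i with rfl | h
  · rw [TG_zero]
    rcases Nat.lt_or_ge j r with h1 | h1
    · rw [TG_SO _ _ _ _ _ _ _ _ j (by omega) h1]
      exact (SO_LO_comm _ _ _ _ _ _ _ _ _ _ (by simp <;> omega) (by simp <;> omega) f).symm
    · obtain rfl : j = r := by omega
      rw [TG_LO]
      exact LO_LO_comm _ _ _ _ _ _ _ _ _ _ _ _ (by simp <;> omega) f
  · rw [TG_SO _ _ _ _ _ _ _ _ i (by omega) (by omega)]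
    rcases Nat.lt_or_ge j r with h1 | h1
    · rw [TG_SO _ _ _ _ _ _ _ _ j (by omega) h1]
      exact SO_SO_comm _ _ _ _ _ _ _ _ (by simp <;> omega) (by simp <;> omega) (by simp <;> omega)
        (by simp <;> omega) f
    · obtain rfl : j = r := by omega
      rw [TG_LO]
      exact SO_LO_comm _ _ _ _ _ _ _ _ _ _ (by simp <;> omega) (by simp <;> omega) f

theorem TG_br3 (i : ℕ) (hi : 1 ≤ i) (hi' : i + 1 < r) :
    TG (qh : F) k0 u0 k kr ur th hr i * TG (qh : F) k0 u0 k kr ur th hr (i + 1) *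
      TG (qh : F) k0 u0 k kr ur th hr i =
    TG (qh : F) k0 u0 k kr ur th hr (i + 1) * TG (qh : F) k0 u0 k kr ur th hr i *
      TG (qh : F) k0 u0 k kr ur th hr (i + 1) := by
  apply LinearMap.ext
  intro f
  rw [TG_SO _ _ _ _ _ _ _ _ i hi (by omega), TG_SO _ _ _ _ _ _ _ _ (i + 1) (by omega) hi']
  exact SO_braid3 _ k.ne_zero _ _ _ (by simp <;> omega) (by simp) (by simp <;> omega) f

theorem TG_br4 :
    TG (qh : F) k0 u0 k kr ur th hr (r - 1) * TG (qh : F) k0 u0 k kr ur th hr r *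
      TG (qh : F) k0 u0 k kr ur th hr (r - 1) * TG (qh : F) k0 u0 k kr ur th hr r =
    TG (qh : F) k0 u0 k kr ur th hr r * TG (qh : F) k0 u0 k kr ur th hr (r - 1) *
      TG (qh : F) k0 u0 k kr ur th hr r * TG (qh : F) k0 u0 k kr ur th hr (r - 1) := by
  apply LinearMap.ext
  intro f
  rw [TG_SO _ _ _ _ _ _ _ _ (r - 1) (by omega) (by omega), TG_LO]
  exact SO_LO_braid4 _ k.ne_zero _ _ (by simp <;> omega) _ _ _ kr.ne_zero ur.ne_zero one_ne_zero _
    thOK_one.hth thOK_one.th0 thOK_one.thh thOK_one.thn _ (Or.inl rfl) f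

theorem TG_br0 (hth : ThOK (qh : F) th) :
    TG (qh : F) k0 u0 k kr ur th hr 1 * TG (qh : F) k0 u0 k kr ur th hr 0 *
      TG (qh : F) k0 u0 k kr ur th hr 1 * TG (qh : F) k0 u0 k kr ur th hr 0 =
    TG (qh : F) k0 u0 k kr ur th hr 0 * TG (qh : F) k0 u0 k kr ur th hr 1 *
      TG (qh : F) k0 u0 k kr ur th hr 0 * TG (qh : F) k0 u0 k kr ur th hr 1 := by
  apply LinearMap.ext
  intro f
  rw [TG_SO _ _ _ _ _ _ _ _ 1 (by omega) (by omega), TG_zero, ← SO_symm]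
  exact SO_LO_braid4 _ k.ne_zero _ _ (by simp) _ _ _ k0.ne_zero u0.ne_zero qh.ne_zero _
    hth.hth hth.th0 hth.thh hth.thn _ (Or.inr rfl) f

end Glob


/-! ### The operators `Y_i` as elements of a group -/

section YList

theorem Pg_list {G : Type*} [Group G] (T : ℕ → G) (r n : ℕ) (hn : n ≤ r) :
    Pg T r n = (((List.range n).map fun m => r - n + m).map T).prod * T r *
      (((List.range n).map fun m => r - 1 - m).map T).prod := by
  induction n with
  | zero => simp [Pg]
  | succ n ih =>
    have h1 : (List.range (n + 1)).map (fun m => r - (n + 1) + m) =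
        (r - n - 1) :: (List.range n).map fun m => r - n + m := by
      rw [List.range_succ_eq_map, List.map_cons, List.map_map]
      congr 1
      apply List.map_congr_left
      intro m _
      simp; omega
    have h2 : (List.range (n + 1)).map (fun m => r - 1 - m) =
        ((List.range n).map fun m => r - 1 - m) ++ [r - n - 1] := by
      rw [List.range_succ, List.map_append]
      simp; omega
    rw [h1, h2, Pg, ih (by omega)]
    simp only [List.map_cons, List.prod_cons, List.map_append, List.prod_append, List.map_nil,
      List.prod_nil, mul_one, mul_assoc]

/-- the word of inverses in the definition of `Y_i` -/
def invL (i : ℕ) : List ℕ := ((List.range (i - 1)).map (· + 1)).reverse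

theorem Yg_list {G : Type*} [Group G] (T : ℕ → G) (r : ℕ) (hr : 2 ≤ r) (n : ℕ) (hn : n < r) :
    Yg T r n = ((invL (n + 1)).map fun j => (T j)⁻¹).prod * ((Ylist r (n + 1)).map T).prod := by
  induction n with
  | zero =>
    rw [Yg, Pg_list T r (r - 1) (by omega)]
    have : (List.range (r - 1)).map (fun m => r - (r - 1) + m) = (List.range (r - 1)).map (· + 1) := by
      apply List.map_congr_left
      intro m _
      omega
    rw [this]
    simp [invL, Ylist, mul_assoc]
  | succ n ih =>
    rw [Yg, ih (by omega)]
    have h1 : invL (n + 1 + 1) = (n + 1) :: invL (n + 1) := by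
      simp [invL, List.range_succ]
    have h2 : Ylist r (n + 1) = Ylist r (n + 1 + 1) ++ [n + 1] := by
      unfold Ylist
      rw [show r - (n + 1) = (r - (n + 1 + 1)) + 1 by omega, List.range_succ]
      simp
      omega
    rw [h1, h2]
    simp only [List.map_cons, List.prod_cons, List.map_append, List.prod_append, List.map_nil,
      List.prod_nil, mul_one, mul_assoc, mul_inv_cancel]

theorem invL_le (r i : ℕ) (hi : i ≤ r) : ∀ j ∈ invL i, j ≤ r := by
  intro j hj
  simp [invL] at hj
  omega

theorem Ylist_le (r i : ℕ) : ∀ j ∈ Ylist r i, j ≤ r := by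
  intro j hj
  simp [Ylist] at hj
  rcases hj with rfl | ⟨a, _, rfl⟩ | rfl | ⟨a, _, rfl⟩ <;> omega

variable {F r}

theorem TG_Y_comm (qh k0 u0 k kr ur : Fˣ) (th : ℝ → F) (hr : 2 ≤ r) (hth : ThOK (qh : F) th)
    (TI : ℕ → Module.End F (QA F r))
    (hTI : ∀ j, TI j = TG (qh : F) k0 u0 k kr ur th hr j -
      ((kpar F r k0 k kr j : F) - (kpar F r k0 k kr j : F)⁻¹) • 1)
    (i j : ℕ) (hi : 1 ≤ i) (hi' : i ≤ r) (hj : 1 ≤ j) (hj' : j ≤ r) :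
    Commute (((invL i).map TI).prod * ((Ylist r i).map (TG (qh : F) k0 u0 k kr ur th hr)).prod)
      (((invL j).map TI).prod * ((Ylist r j).map (TG (qh : F) k0 u0 k kr ur th hr)).prod) := by
  have hu : ∀ j, ∃ u : (Module.End F (QA F r))ˣ, j ≤ r →
      ((u : Module.End F (QA F r)) = TG (qh : F) k0 u0 k kr ur th hr j ∧
        ((u⁻¹ : (Module.End F (QA F r))ˣ) : Module.End F (QA F r)) = TI j) := by
    intro j
    by_cases hj : j ≤ r
    · refine ⟨⟨TG (qh : F) k0 u0 k kr ur th hr j, TI j, ?_, ?_⟩, fun _ => ⟨rfl, rfl⟩⟩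
      · apply LinearMap.ext; intro f
        rw [hTI]
        simp only [Module.End.mul_apply, LinearMap.sub_apply, LinearMap.smul_apply, map_sub, map_smul,
          Module.End.one_apply, TG_quad qh k0 u0 k kr ur th hr hth j hj]
        abel
      · apply LinearMap.ext; intro f
        rw [hTI]
        simp only [Module.End.mul_apply, LinearMap.sub_apply, LinearMap.smul_apply, map_sub, map_smul,
          Module.End.one_apply, TG_quad qh k0 u0 k kr ur th hr hth j hj]
        abel
    · exact ⟨1, fun h => absurd h hj⟩
  choose U hU using hu
  have key : ∀ n, n < r → ((Yg U r n : (Module.End F (QA F r))ˣ) : Module.End F (QA F r)) =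
      ((invL (n + 1)).map TI).prod *
        ((Ylist r (n + 1)).map (TG (qh : F) k0 u0 k kr ur th hr)).prod := by
    intro n hn
    rw [Yg_list U r hr n hn, Units.val_mul]
    have e : ∀ l : List (Module.End F (QA F r))ˣ,
        ((l.prod : (Module.End F (QA F r))ˣ) : Module.End F (QA F r)) = (l.map Units.val).prod :=
      fun l => map_list_prod (Units.coeHom _) l
    rw [e, e, List.map_map, List.map_map]
    congr 2
    · apply List.map_congr_left
      intro m hm
      exact (hU m (invL_le r (n + 1) hn m hm)).2
    · apply List.map_congr_left
      intro m hm
      exact (hU m (Ylist_le r (n + 1) m hm)).1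
  obtain ⟨i, rfl⟩ : ∃ n, i = n + 1 := ⟨i - 1, by omega⟩
  obtain ⟨j, rfl⟩ : ∃ n, j = n + 1 := ⟨j - 1, by omega⟩
  rw [← key i hi', ← key j hj']
  have main := Yg_comm U r hr ?_ ?_ ?_ ?_ i j hi' hj'
  · have := congrArg Units.val main
    simp only [Units.val_mul] at this
    exact this
  · intro a b h1 h2
    apply Units.ext
    simp only [Units.val_mul]
    rw [(hU a (by omega)).1, (hU b h2).1]
    exact TG_far qh k0 u0 k kr ur th hr a b h1 h2
  · intro a h1 h2
    apply Units.ext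
    simp only [Units.val_mul]
    rw [(hU a (by omega)).1, (hU (a + 1) (by omega)).1]
    exact TG_br3 qh k0 u0 k kr ur th hr a h1 h2
  · apply Units.ext
    simp only [Units.val_mul]
    rw [(hU (r - 1) (by omega)).1, (hU r le_rfl).1]
    exact TG_br4 qh k0 u0 k kr ur th hr
  · apply Units.ext
    simp only [Units.val_mul]
    rw [(hU 1 (by omega)).1, (hU 0 (by omega)).1]
    exact TG_br0 qh k0 u0 k kr ur th hr hth

/-- Products of operators agreeing on an invariant subspace agree. -/
theorem prod_agree (V : Submodule F (QA F r)) (A B : ℕ → Module.End F (QA F r)) (l : List ℕ)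
    (h1 : ∀ j ∈ l, ∀ f ∈ V, A j f = B j f) (h2 : ∀ j ∈ l, ∀ f ∈ V, B j f ∈ V) (f : QA F r) (hf : f ∈ V) :
    (l.map A).prod f = (l.map B).prod f ∧ (l.map B).prod f ∈ V := by
  induction l with
  | nil => simpa using hf
  | cons a l ih =>
    obtain ⟨e1, e2⟩ := ih (fun j hj => h1 j (List.mem_cons_of_mem _ hj))
      (fun j hj => h2 j (List.mem_cons_of_mem _ hj))
    simp only [List.map_cons, List.prod_cons, Module.End.mul_apply]
    rw [e1]
    exact ⟨h1 a List.mem_cons_self _ e2, h2 a List.mem_cons_self _ e2⟩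

/-- Reduction of the statement to properties of the orbit. -/
theorem reduction (qh k0 u0 k kr ur : Fˣ) (th : ℝ → F) (hr : 2 ≤ r) (hth : ThOK (qh : F) th)
    (t : Fin r → Fˣ) (V : Submodule F (QA F r))
    (h0 : ∀ f ∈ V, T0op F r qh (k0 : F) u0 t f = TG (qh : F) k0 u0 k kr ur th hr 0 f)
    (hV : ∀ j ≤ r, ∀ f ∈ V, TG (qh : F) k0 u0 k kr ur th hr j f ∈ V)
    (i j : ℕ) (hi : 1 ≤ i) (hi' : i ≤ r) (hj : 1 ≤ j) (hj' : j ≤ r) (f : QA F r) (hf : f ∈ V) :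
      Yop F r qh (k0 : F) (u0 : F) (k : F) (kr : F) (ur : F) t i
          (Yop F r qh (k0 : F) (u0 : F) (k : F) (kr : F) (ur : F) t j f)
        = Yop F r qh (k0 : F) (u0 : F) (k : F) (kr : F) (ur : F) t j
            (Yop F r qh (k0 : F) (u0 : F) (k : F) (kr : F) (ur : F) t i f) := by
  obtain ⟨TI, hTI⟩ : ∃ TI : ℕ → Module.End F (QA F r), ∀ j, TI j = TG (qh : F) k0 u0 k kr ur th hr j -
      ((kpar F r k0 k kr j : F) - (kpar F r k0 k kr j : F)⁻¹) • 1 := ⟨_, fun _ => rfl⟩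
  have a1 : ∀ j, ∀ f ∈ V, Tfull F r qh (k0 : F) u0 k kr ur t j f =
      TG (qh : F) k0 u0 k kr ur th hr j f := by
    intro j f hf
    by_cases hj : j = 0
    · subst hj; rw [Tfull, if_pos rfl]; exact h0 f hf
    · rw [Tfull, TG, if_neg hj, if_neg hj]
  have a2 : ∀ j, ∀ f ∈ V, TfullInv F r qh (k0 : F) u0 k kr ur t j f = TI j f := by
    intro j f hf
    rw [TfullInv, hTI, LinearMap.sub_apply, LinearMap.sub_apply, a1 j f hf]
  have a3 : ∀ j ≤ r, ∀ f ∈ V, TI j f ∈ V := by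
    intro j hj f hf
    rw [hTI]
    exact V.sub_mem (hV j hj f hf) (V.smul_mem _ hf)
  have a4 : ∀ i ≤ r, ∀ f ∈ V, Yop F r qh (k0 : F) (u0 : F) (k : F) (kr : F) (ur : F) t i f =
      (((invL i).map TI).prod * ((Ylist r i).map (TG (qh : F) k0 u0 k kr ur th hr)).prod) f ∧
      (((invL i).map TI).prod * ((Ylist r i).map (TG (qh : F) k0 u0 k kr ur th hr)).prod) f ∈ V := by
    intro i hi f hf
    obtain ⟨e1, e2⟩ := prod_agree V _ _ (Ylist r i) (fun j _ => a1 j)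
      (fun j hj => hV j (Ylist_le r i j hj)) f hf
    obtain ⟨e3, e4⟩ := prod_agree V _ _ (invL i) (fun j _ => a2 j)
      (fun j hj => a3 j (invL_le r i hi j hj)) _ e2
    refine ⟨?_, e4⟩
    rw [Yop, Module.End.mul_apply, Module.End.mul_apply, e1]
    exact e3
  have hc := TG_Y_comm qh k0 u0 k kr ur th hr hth TI hTI i j hi hi' hj hj'
  rw [(a4 j hj' f hf).1, (a4 i hi' f hf).1, (a4 i hi' _ (a4 j hj' f hf).2).1,
    (a4 j hj' _ (a4 i hi' f hf).2).1]
  exact LinearMap.congr_fun hc f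

end YList


/-! ### Orbits of the affine Weyl group -/

section Orb
variable {F r}

theorem genF_zero (p : Fin r) (hp : (p : ℕ) = 0) (y : E r) :
    genF r 0 y = Function.update y p (1 - y p) := by
  ext m
  rw [genF, if_pos rfl]
  by_cases h : m = p
  · subst h; simp [hp]
  · rw [if_neg (by intro h'; apply h; ext; omega), Function.update_of_ne h]

theorem genF_sw (p q : Fin r) (hpq : (p : ℕ) + 1 = q) (y : E r) : genF r (p + 1) y = sw p q y := by
  rw [genF, if_neg (by omega), sW_sw p q hpq]

theorem genF_ng (p : Fin r) (hp : (p : ℕ) + 1 = r) (y : E r) : genF r r y = ng p y := by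
  rw [genF, if_neg (by omega), sW_ng p hp]

theorem sw_swap (p q : Fin r) (y : E r) : sw p q y = y ∘ (Equiv.swap p q) := by
  ext m
  rw [sw_apply, Function.comp_apply, Equiv.swap_apply_def]
  by_cases h1 : m = p
  · by_cases h2 : m = q
    · simp [h1, ← h2]
    · simp [h1]; intro h; rw [h]
  · by_cases h2 : m = q
    · subst h2; simp [h1]
    · simp [h1, h2]

/-- description of elements of the affine Weyl group -/
def IsAff (g : E r → E r) : Prop :=
  ∃ (π : Equiv.Perm (Fin r)) (σ lam : Fin r → ℤ), (∀ m, σ m = 1 ∨ σ m = -1) ∧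
    ∀ y m, g y m = σ m * y (π m) + lam m

theorem genF_aff (hr : 2 ≤ r) (j : ℕ) (hj : j ≤ r) : IsAff (genF r j) := by
  rcases Nat.eq_zero_or_pos j with rfl | h
  · refine ⟨1, fun m => if m = ⟨0, by omega⟩ then -1 else 1, fun m => if m = ⟨0, by omega⟩ then 1 else 0,
      ?_, ?_⟩
    · intro m; simp only []; split_ifs <;> simp
    · intro y m
      rw [genF_zero ⟨0, by omega⟩ rfl]
      by_cases h : m = ⟨0, by omega⟩
      · subst h; simp; ring
      · simp [h]
  rcases Nat.lt_or_ge j r with h1 | h1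
  · refine ⟨Equiv.swap ⟨j - 1, by omega⟩ ⟨j, h1⟩, fun _ => 1, fun _ => 0, by simp, ?_⟩
    intro y m
    have := genF_sw ⟨j - 1, by omega⟩ ⟨j, h1⟩ (by simp; omega) y
    simp only [show j - 1 + 1 = j by omega] at this
    rw [this, sw_swap]; simp
  · obtain rfl : j = r := by omega
    refine ⟨1, fun m => if m = ⟨j - 1, by omega⟩ then -1 else 1, fun m => 0, ?_, ?_⟩
    · intro m; simp only []; split_ifs <;> simp
    · intro y m
      rw [genF_ng ⟨j - 1, by omega⟩ (by simp; omega), ng_apply]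
      split_ifs with h
      · subst h; simp
      · simp [h]

theorem IsAff.comp {g h : E r → E r} (hg : IsAff g) (hh : IsAff h) : IsAff (fun y => g (h y)) := by
  obtain ⟨π, σ, l, h1, h2⟩ := hg
  obtain ⟨π', σ', l', h1', h2'⟩ := hh
  refine ⟨π.trans π', fun m => σ m * σ' (π m), fun m => σ m * l' (π m) + l m, ?_, ?_⟩
  · intro m
    rcases h1 m with e | e <;> rcases h1' (π m) with e' | e' <;> simp [e, e']
  · intro y m
    change g (h y) m = _
    rw [h2, h2']
    push_cast
    simp only [Equiv.trans_apply]
    ring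

theorem word_aff (hr : 2 ≤ r) (l : List ℕ) (hl : ∀ a ∈ l, a ≤ r) : IsAff (fun y => wordAct r l y) := by
  induction l with
  | nil => exact ⟨1, fun _ => 1, fun _ => 0, by simp, by simp [wordAct]⟩
  | cons a l ih =>
    exact (genF_aff hr a (hl a List.mem_cons_self)).comp
      (ih fun b hb => hl b (List.mem_cons_of_mem _ hb))

theorem genF_invol (hr : 2 ≤ r) (j : ℕ) (hj : j ≤ r) (y : E r) : genF r j (genF r j y) = y := by
  rcases Nat.eq_zero_or_pos j with rfl | h
  · rw [genF_zero ⟨0, by omega⟩ rfl, genF_zero ⟨0, by omega⟩ rfl]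
    simp
  rcases Nat.lt_or_ge j r with h1 | h1
  · have := genF_sw ⟨j - 1, by omega⟩ ⟨j, h1⟩ (by simp; omega)
    simp only [show j - 1 + 1 = j by omega] at this
    rw [this, this, sw_swap, sw_swap]
    ext m; simp
  · obtain rfl : j = r := by omega
    rw [genF_ng ⟨j - 1, by omega⟩ (by simp; omega), genF_ng ⟨j - 1, by omega⟩ (by simp; omega)]
    simp [ng]

theorem word_append (l l' : List ℕ) (y : E r) : wordAct r (l ++ l') y = wordAct r l (wordAct r l' y) := by
  simp [wordAct]

theorem word_rev (hr : 2 ≤ r) (l : List ℕ) (hl : ∀ a ∈ l, a ≤ r) (y : E r) :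
    wordAct r l (wordAct r l.reverse y) = y := by
  induction l generalizing y with
  | nil => rfl
  | cons a l ih =>
    rw [List.reverse_cons, word_append]
    change genF r a (wordAct r l (wordAct r l.reverse (genF r a y))) = y
    rw [ih fun b hb => hl b (List.mem_cons_of_mem _ hb), genF_invol hr a (hl a List.mem_cons_self)]

theorem orbit_gen (y0 : E r) (j : ℕ) (hj : j ≤ r) (z : E r) (hz : z ∈ orbit r y0) :
    genF r j z ∈ orbit r y0 := by
  obtain ⟨l, hl, rfl⟩ := hz
  refine ⟨j :: l, ?_, rfl⟩
  intro a ha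
  rcases List.mem_cons.mp ha with rfl | h
  · exact hj
  · exact hl a h

theorem orbit_self (y : E r) : y ∈ orbit r y := ⟨[], by simp, rfl⟩

theorem orbit_word (y0 : E r) (l : List ℕ) (hl : ∀ a ∈ l, a ≤ r) (z : E r) (hz : z ∈ orbit r y0) :
    wordAct r l z ∈ orbit r y0 := by
  obtain ⟨l', hl', rfl⟩ := hz
  refine ⟨l ++ l', ?_, word_append _ _ _⟩
  intro a ha
  rcases List.mem_append.mp ha with h | h
  · exact hl a h
  · exact hl' a h

theorem orbit_rel (hr : 2 ≤ r) (y0 y z : E r) (hy : y ∈ orbit r y0) (hz : z ∈ orbit r y0) :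
    ∃ l : List ℕ, (∀ a ∈ l, a ≤ r) ∧ wordAct r l y = z := by
  obtain ⟨l, hl, rfl⟩ := hy
  obtain ⟨l', hl', rfl⟩ := hz
  have hlr : ∀ a ∈ l.reverse, a ≤ r := fun a ha => hl a (List.mem_reverse.mp ha)
  refine ⟨l' ++ l.reverse, ?_, ?_⟩
  · intro a ha
    rcases List.mem_append.mp ha with h | h
    · exact hl' a h
    · exact hlr a h
  · rw [word_append]
    have := word_rev hr l.reverse hlr y0
    rw [List.reverse_reverse] at this
    rw [this]

/-! Closure properties of a set stable under the generators. -/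



theorem O_perm (O : Set (E r)) (hr : 2 ≤ r) (hG : ∀ j ≤ r, ∀ z ∈ O, genF r j z ∈ O)
    (π : Equiv.Perm (Fin r)) : ∀ z ∈ O, z ∘ π ∈ O := by
  obtain ⟨n, rfl⟩ : ∃ n, r = n + 1 := ⟨r - 1, by omega⟩
  have hπ : π ∈ Submonoid.closure (Set.range fun i : Fin n ↦ Equiv.swap i.castSucc i.succ) := by
    rw [Equiv.Perm.mclosure_swap_castSucc_succ]; trivial
  induction hπ using Submonoid.closure_induction with
  | mem x hx =>
    obtain ⟨i, rfl⟩ := hx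
    intro z hz
    have := hG (i.castSucc + 1) (by simp) z hz
    rw [genF_sw i.castSucc i.succ (by simp), sw_swap] at this
    exact this
  | one => intro z hz; exact hz
  | mul x y _ _ hx hy => intro z hz; exact hy _ (hx z hz)

theorem O_ng (O : Set (E r)) (hr : 2 ≤ r) (hG : ∀ j ≤ r, ∀ z ∈ O, genF r j z ∈ O)
    (p : Fin r) : ∀ z ∈ O, ng p z ∈ O := by
  intro z hz
  have h1 := O_perm O hr hG (Equiv.swap p ⟨r - 1, by omega⟩) z hz
  have h2 := hG r le_rfl _ h1
  rw [genF_ng ⟨r - 1, by omega⟩ (by simp; omega)] at h2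
  have h3 := O_perm O hr hG (Equiv.swap p ⟨r - 1, by omega⟩) _ h2
  convert h3 using 1
  ext m
  simp only [Function.comp_apply, ng_apply, Equiv.swap_apply_self, Equiv.swap_apply_right]
  by_cases h : m = p
  · subst h; simp
  · rw [if_neg h, if_neg]
    intro h'
    apply h
    have := congrArg (Equiv.swap p ⟨r - 1, by omega⟩) h'
    simpa using this

theorem O_tr1 (O : Set (E r)) (hr : 2 ≤ r) (hG : ∀ j ≤ r, ∀ z ∈ O, genF r j z ∈ O)
    (p : Fin r) : ∀ z ∈ O, Function.update z p (z p + 1) ∈ O := by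
  intro z hz
  have h1 := O_perm O hr hG (Equiv.swap p ⟨0, by omega⟩) z hz
  have h2 := hG 0 (by omega) _ (O_ng O hr hG ⟨0, by omega⟩ _ h1)
  rw [genF_zero ⟨0, by omega⟩ rfl] at h2
  have h3 := O_perm O hr hG (Equiv.swap p ⟨0, by omega⟩) _ h2
  convert h3 using 1
  ext m
  simp only [Function.comp_apply, Function.update_apply, ng_apply, Equiv.swap_apply_self, Equiv.swap_apply_right]
  by_cases h : m = p
  · subst h; simp; ring
  · have : Equiv.swap p ⟨0, by omega⟩ m ≠ ⟨0, by omega⟩ := by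
      intro h'
      apply h
      have := congrArg (Equiv.swap p ⟨0, by omega⟩) h'
      simpa using this
    rw [if_neg h, if_neg this, if_neg this]

theorem O_tr (O : Set (E r)) (hr : 2 ≤ r) (hG : ∀ j ≤ r, ∀ z ∈ O, genF r j z ∈ O)
    (p : Fin r) (n : ℤ) : ∀ z ∈ O, Function.update z p (z p + n) ∈ O := by
  intro z hz
  induction n using Int.induction_on with
  | zero => simpa using hz
  | succ n ih =>
    have := O_tr1 O hr hG p _ ih
    convert this using 1
    simp
    ring_nf
  | pred n ih =>
    have := O_ng O hr hG p _ (O_tr1 O hr hG p _ (O_ng O hr hG p _ ih))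
    convert this using 1
    simp [ng]
    ring_nf

theorem O_all (O : Set (E r)) (hr : 2 ≤ r) (hG : ∀ j ≤ r, ∀ z ∈ O, genF r j z ∈ O)
    (z w : E r) (hz : z ∈ O) (h : ∀ m, ∃ n : ℤ, w m = z m + n ∨ w m = -z m + n) : w ∈ O := by
  suffices hS : ∀ S : Finset (Fin r), S.piecewise w z ∈ O by simpa using hS Finset.univ
  intro S
  induction S using Finset.induction_on with
  | empty => simpa using hz
  | insert a s ha ih =>
    rw [Finset.piecewise_insert]
    obtain ⟨n, hn | hn⟩ := h a
    · have := O_tr O hr hG a n _ ih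
      rwa [Finset.piecewise_eq_of_notMem _ _ _ ha, ← hn] at this
    · have := O_tr O hr hG a n _ (O_ng O hr hG a _ ih)
      simp only [ng, Function.update_self, Function.update_idem] at this
      rwa [Finset.piecewise_eq_of_notMem _ _ _ ha, ← hn] at this

theorem O_alcove (O : Set (E r)) (hr : 2 ≤ r) (hG : ∀ j ≤ r, ∀ z ∈ O, genF r j z ∈ O)
    (z : E r) (hz : z ∈ O) : ∃ c ∈ O, c ∈ CplusCl r := by
  set w : E r := fun m => |z m - round (z m)| with hw
  have hwO : w ∈ O := by
    refine O_all O hr hG z w hz fun m => ?_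
    rcases le_total 0 (z m - round (z m)) with h | h
    · exact ⟨-round (z m), Or.inl (by simp only [hw]; rw [abs_of_nonneg h]; push_cast; ring)⟩
    · exact ⟨round (z m), Or.inr (by simp only [hw]; rw [abs_of_nonpos h]; push_cast; ring)⟩
  refine ⟨_, O_perm O hr hG (Tuple.sort fun m => -w m) w hwO, ?_, ?_⟩
  · intro i j hij
    have := Tuple.monotone_sort (fun m => -w m) hij
    simp only [Function.comp_apply] at this ⊢
    linarith
  · intro m
    exact ⟨abs_nonneg _, abs_sub_round _⟩

end Orb

section Orb2
variable {F r}

theorem alcove_unique (hr : 2 ≤ r) (c c' : E r) (hc : c ∈ CplusCl r) (hc' : c' ∈ CplusCl r)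
    (l : List ℕ) (hl : ∀ a ∈ l, a ≤ r) (h : wordAct r l c = c') : c' = c := by
  obtain ⟨π, σ, lam, h1, h2⟩ := word_aff hr l hl
  have key : c' = c ∘ π := by
    ext m
    have e := h2 c m
    simp only [h] at e
    obtain ⟨a1, a2⟩ := hc.2 (π m)
    obtain ⟨b1, b2⟩ := hc'.2 m
    simp only [Function.comp_apply]
    rcases h1 m with h | h
    · rw [h] at e
      have l1 : ((-1 : ℤ) : ℝ) < lam m := by push_cast at e ⊢; linarith
      have l2 : (lam m : ℝ) < ((1 : ℤ) : ℝ) := by push_cast at e ⊢; linarith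
      have l1' := Int.cast_lt.mp l1
      have l2' := Int.cast_lt.mp l2
      have : lam m = 0 := by omega
      rw [this] at e; push_cast at e; linarith
    · rw [h] at e
      have l1 : ((-1 : ℤ) : ℝ) < lam m := by push_cast at e ⊢; linarith
      have l2 : (lam m : ℝ) < ((2 : ℤ) : ℝ) := by push_cast at e ⊢; linarith
      have l1' := Int.cast_lt.mp l1
      have l2' := Int.cast_lt.mp l2
      have : lam m = 0 ∨ lam m = 1 := by omega
      rcases this with h' | h' <;> rw [h'] at e <;> push_cast at e <;> linarith
  have := Tuple.unique_antitone (f := c) (σ := π) (τ := 1)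
    (by rw [← key]; exact fun i j hij => hc'.1 i j hij) (fun i j hij => hc.1 i j hij)
  rw [key, this]
  rfl


theorem hG_of (O : Set (E r)) (hO : IsOrbit r O) (hr : 2 ≤ r)
    : ∀ j ≤ r, ∀ z ∈ O, genF r j z ∈ O := by
  obtain ⟨y0, rfl⟩ := hO
  exact fun j hj z hz => orbit_gen y0 j hj z hz

theorem cpt_spec (O : Set (E r)) (hO : IsOrbit r O) (hr : 2 ≤ r)
    : cpt r O ∈ O ∧ cpt r O ∈ CplusCl r := by
  have hG := hG_of O hO hr
  obtain ⟨y0, rfl⟩ := hO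
  have h : ∃ c, c ∈ orbit r y0 ∧ c ∈ CplusCl r := by
    obtain ⟨c, h1, h2⟩ := O_alcove _ hr hG y0 (orbit_self y0)
    exact ⟨c, h1, h2⟩
  rw [cpt, dif_pos h]
  exact h.choose_spec

theorem gW_spec (O : Set (E r)) (hO : IsOrbit r O) (hr : 2 ≤ r)
    (y : E r) (hy : y ∈ O) :
    (∀ a ∈ gW r y, a ≤ r) ∧ wordAct r (gW r y) (cpt r O) = y := by
  have hc := cpt_spec O hO hr
  obtain ⟨y0, rfl⟩ := hO
  obtain ⟨l0, hl0, hl0'⟩ := orbit_rel hr y0 y _ hy hc.1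
  have hex : ∃ n, ∃ l : List ℕ, l.length = n ∧ (∀ a ∈ l, a ≤ r) ∧ wordAct r l.reverse y ∈ CplusCl r :=
    ⟨_, l0.reverse, rfl, fun a ha => hl0 a (List.mem_reverse.mp ha), by
      rw [List.reverse_reverse, hl0']; exact hc.2⟩
  have h : ∃ l : List ℕ, (∀ a ∈ l, a ≤ r) ∧ wordAct r l.reverse y ∈ CplusCl r ∧
      ∀ l' : List ℕ, (∀ a ∈ l', a ≤ r) → wordAct r l'.reverse y ∈ CplusCl r →
        l.length ≤ l'.length := by
    obtain ⟨l, h1, h2, h3⟩ := Nat.find_spec hex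
    refine ⟨l, h2, h3, fun l' h4 h5 => ?_⟩
    rw [h1]
    exact Nat.find_min' hex ⟨l', rfl, h4, h5⟩
  have hs : (∀ a ∈ gW r y, a ≤ r) ∧ wordAct r (gW r y).reverse y ∈ CplusCl r := by
    rw [gW, dif_pos h]
    exact ⟨h.choose_spec.1, h.choose_spec.2.1⟩
  refine ⟨hs.1, ?_⟩
  have hrev : ∀ a ∈ (gW r y).reverse, a ≤ r := fun a ha => hs.1 a (List.mem_reverse.mp ha)
  obtain ⟨l, hl, hl'⟩ := orbit_rel hr y0 _ _ hc.1 (orbit_word y0 _ hrev y hy)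
  have := alcove_unique hr _ _ hc.2 hs.2 l hl hl'
  rw [← this]
  exact word_rev hr _ hs.1 y

end Orb2


/-! ### The character `θ` attached to an orbit -/

section Theta
variable {F r}

/-- extension of a function on `[0,1/2]` to a quasi-periodic odd function -/
def tht (qh : Fˣ) (φ : ℝ → Fˣ) (z : ℝ) : Fˣ :=
  (qh * qh) ^ ⌊z + 1 / 2⌋ *
    (if 0 ≤ z - ⌊z + 1 / 2⌋ then φ (z - ⌊z + 1 / 2⌋) else (φ (⌊z + 1 / 2⌋ - z))⁻¹)

theorem tht_int (qh : Fˣ) (φ : ℝ → Fˣ) (z : ℝ) (n : ℤ) :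
    tht qh φ (z + n) = (qh * qh) ^ n * tht qh φ z := by
  have h : ⌊z + n + 1 / 2⌋ = ⌊z + 1 / 2⌋ + n := by
    rw [show z + n + 1 / 2 = z + 1 / 2 + n by ring, Int.floor_add_intCast]
  unfold tht
  rw [h]
  push_cast
  rw [show z + n - ((⌊z + 1 / 2⌋ : ℝ) + n) = z - ⌊z + 1 / 2⌋ by ring,
    show ((⌊z + 1 / 2⌋ : ℝ) + n) - (z + n) = ⌊z + 1 / 2⌋ - z by ring, zpow_add, ← mul_assoc,
    mul_comm ((qh * qh) ^ n)]

theorem tht_pos (qh : Fˣ) (φ : ℝ → Fˣ) (h2 : φ (1 / 2) = qh) (s : ℝ) (hs : 0 ≤ s)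
    (hs' : s ≤ 1 / 2) : tht qh φ s = φ s := by
  rcases hs'.lt_or_eq with h | h
  · have : ⌊s + 1 / 2⌋ = 0 := by rw [Int.floor_eq_iff]; push_cast; constructor <;> linarith
    simp only [tht]; rw [this]
    simp [hs]
  · subst h
    have : ⌊(1 / 2 : ℝ) + 1 / 2⌋ = 1 := by rw [Int.floor_eq_iff]; norm_num
    simp only [tht]; rw [this, if_neg (by norm_num)]
    rw [show ((1 : ℤ) : ℝ) - 1 / 2 = 1 / 2 by norm_num, h2]
    simp

theorem tht_neg (qh : Fˣ) (φ : ℝ → Fˣ) (h0 : φ 0 = 1) (s : ℝ) (hs : 0 ≤ s)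
    (hs' : s ≤ 1 / 2) : tht qh φ (-s) = (φ s)⁻¹ := by
  have : ⌊-s + 1 / 2⌋ = 0 := by rw [Int.floor_eq_iff]; push_cast; constructor <;> linarith
  simp only [tht]; rw [this]
  rcases hs.lt_or_eq with h | h
  · rw [if_neg (by push_cast; linarith)]; simp
  · subst h; simp [h0]

theorem tht_symm (qh : Fˣ) (φ : ℝ → Fˣ) (h0 : φ 0 = 1) (h2 : φ (1 / 2) = qh) (z : ℝ) :
    tht qh φ (-z) * tht qh φ z = 1 := by
  have e : z = (z - round z) + (round z : ℤ) := by ring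
  have e' : -z = -(z - round z) + ((-round z : ℤ) : ℝ) := by push_cast; ring
  have hb := abs_sub_round z
  have f1 := tht_int qh φ (-(z - round z)) (-round z)
  have f2 := tht_int qh φ (z - round z) (round z)
  rw [← e'] at f1
  rw [← e] at f2
  rw [f1, f2]
  have key : tht qh φ (-(z - round z)) * tht qh φ (z - round z) = 1 := by
    rcases le_total 0 (z - round z) with h | h
    · rw [abs_of_nonneg h] at hb
      rw [tht_neg qh φ h0 _ h hb, tht_pos qh φ h2 _ h hb]; simp
    · rw [abs_of_nonpos h] at hb
      have h' : 0 ≤ -(z - round z) := by linarith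
      rw [tht_pos qh φ h2 _ h' hb]
      nth_rewrite 2 [← neg_neg (z - (round z : ℝ))]
      rw [tht_neg qh φ h0 _ h' hb]; simp
  rw [mul_mul_mul_comm, key, zpow_neg]; simp

theorem tht_ok (qh : Fˣ) (φ : ℝ → Fˣ) (h0 : φ 0 = 1) (h2 : φ (1 / 2) = qh) :
    ThOK (qh : F) (fun s => ((tht qh φ (-s) : Fˣ) : F)) where
  hth := by
    intro z
    have := tht_int qh φ (-z) (-1)
    push_cast at this
    rw [show -(z + 1) = -z + -1 by ring, this]
    simp [mul_comm]
  th0 := by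
    have := tht_neg qh φ h0 0 le_rfl (by norm_num)
    rw [this, h0]; simp
  thh := by
    have := tht_neg qh φ h0 (1 / 2) (by norm_num) le_rfl
    rw [this, h2]; simp
  thn := by
    intro z
    have := tht_symm qh φ h0 h2 (-z)
    rw [← Units.val_mul, this]; simp

theorem tht_c (qh : Fˣ) (φ : ℝ → Fˣ) (h0 : φ 0 = 1) (h2 : φ (1 / 2) = qh) (s : ℝ) (hs : 0 ≤ s)
    (hs' : s ≤ 1 / 2) (σ n : ℤ) (hσ : σ = 1 ∨ σ = -1) :
    tht qh φ (σ * s + n) = (qh * qh) ^ n * φ s ^ σ := by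
  rw [tht_int]
  rcases hσ with rfl | rfl
  · simp only [Int.cast_one, one_mul, tht_pos qh φ h2 s hs hs', zpow_one]
  · simp only [Int.cast_neg, Int.cast_one, neg_mul, one_mul, tht_neg qh φ h0 s hs hs', zpow_neg_one]

theorem torusAct_aff (qh : Fˣ) (t : Fin r → Fˣ) (g : E r → E r) (π : Equiv.Perm (Fin r))
    (σ lam : Fin r → ℤ) (h : ∀ y m, g y m = σ m * y (π m) + lam m) (m : Fin r) :
    torusAct F r qh g t m = (qh * qh) ^ lam m * t (π m) ^ σ m := by
  unfold torusAct
  have e0 : g 0 m = lam m := by rw [h]; simp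
  rw [e0, Int.floor_intCast]
  congr 1
  rw [Finset.prod_eq_single (π m)]
  · have : (g (eV r (π m)) - g 0) m = σ m := by
      rw [Pi.sub_apply, e0, h]; simp [eV]
    rw [this, Int.floor_intCast]
  · intro b _ hb
    have : (g (eV r b) - g 0) m = 0 := by
      rw [Pi.sub_apply, e0, h]; simp [eV, hb.symm]
    rw [this]; simp
  · simp

/-- the base function on `[0,1/2]` -/
def phi0 (qh : Fˣ) (c : E r) (t : Fin r → Fˣ) (s : ℝ) : Fˣ :=
  if s = 0 then 1 else if s = 1 / 2 then qh else if h : ∃ j, c j = s then t h.choose else 1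

section TO

theorem TO_eq (O : Set (E r)) (hO : IsOrbit r O) (hr : 2 ≤ r) (qh : Fˣ) (t : Fin r → Fˣ)
    (ht : t ∈ TOset F r qh O)
    : ∀ (n : ℕ) (i j : Fin r), (i : ℕ) + n = j → cpt r O i = cpt r O j → t i = t j := by
  have hc := (cpt_spec O hO hr).2
  intro n
  induction n with
  | zero => intro i j h _; rw [show i = j by ext; omega]
  | succ n ih =>
    intro i j h e
    have hj := j.2
    have b1 : cpt r O ⟨i + 1, by omega⟩ ≤ cpt r O i := hc.1 _ _ (by rw [Fin.le_def]; simp)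
    have b2 : cpt r O j ≤ cpt r O ⟨i + 1, by omega⟩ := hc.1 _ _ (by rw [Fin.le_def]; simp; omega)
    have e1 : cpt r O i = cpt r O ⟨i + 1, by omega⟩ := by linarith
    have := ht (i + 1) (by omega) (by
      rw [alphaF, if_neg (by omega), if_neg (by omega), cd_eq _ i _ rfl, cd_eq _ ⟨i + 1, by omega⟩ _ rfl]
      linarith)
    rw [tpowCo, if_neg (by omega), if_neg (by omega), tcU_eq _ i _ rfl, tcU_eq _ ⟨i + 1, by omega⟩ _ rfl,
      mul_inv_eq_one] at this
    rw [this]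
    exact ih _ _ (by simp; omega) (by linarith)

theorem TO_eq' (O : Set (E r)) (hO : IsOrbit r O) (hr : 2 ≤ r) (qh : Fˣ) (t : Fin r → Fˣ)
    (ht : t ∈ TOset F r qh O)
    (i j : Fin r) (e : cpt r O i = cpt r O j) : t i = t j := by
  rcases le_total (i : ℕ) j with h | h
  · exact TO_eq O hO hr qh t ht (j - i) i j (by omega) e
  · exact (TO_eq O hO hr qh t ht (i - j) j i (by omega) e.symm).symm

theorem TO_zero (O : Set (E r)) (hO : IsOrbit r O) (hr : 2 ≤ r) (qh : Fˣ) (t : Fin r → Fˣ)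
    (ht : t ∈ TOset F r qh O)
    (i : Fin r) (e : cpt r O i = 0) : t i = 1 := by
  have hc := (cpt_spec O hO hr).2
  have b : cpt r O ⟨r - 1, by omega⟩ ≤ cpt r O i := hc.1 _ _ (by rw [Fin.le_def]; simp; omega)
  have b' := (hc.2 ⟨r - 1, by omega⟩).1
  have h : cpt r O ⟨r - 1, by omega⟩ = 0 := by linarith
  rw [TO_eq' O hO hr qh t ht i ⟨r - 1, by omega⟩ (by rw [e, h])]
  have := ht r le_rfl (by
    rw [alphaF, if_neg (by omega), if_pos rfl, cd_eq _ ⟨r - 1, by omega⟩ _ (by simp; omega), h]; simp)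
  rwa [tpowCo, if_neg (by omega), if_pos rfl, tcU_eq _ ⟨r - 1, by omega⟩ _ (by simp; omega)] at this

theorem TO_half (O : Set (E r)) (hO : IsOrbit r O) (hr : 2 ≤ r) (qh : Fˣ) (t : Fin r → Fˣ)
    (ht : t ∈ TOset F r qh O)
    (i : Fin r) (e : cpt r O i = 1 / 2) : t i = qh := by
  have hc := (cpt_spec O hO hr).2
  have b : cpt r O i ≤ cpt r O ⟨0, by omega⟩ := hc.1 _ _ (by rw [Fin.le_def]; simp)
  have b' := (hc.2 ⟨0, by omega⟩).2
  have h : cpt r O ⟨0, by omega⟩ = 1 / 2 := by linarith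
  rw [TO_eq' O hO hr qh t ht i ⟨0, by omega⟩ (by rw [e, h])]
  have := ht 0 (by omega) (by
    rw [alphaF, if_pos rfl, cd_eq _ ⟨0, by omega⟩ _ (by simp), h]; norm_num)
  rw [tpowCo, if_pos rfl, tcU_eq _ ⟨0, by omega⟩ _ (by simp), mul_inv_eq_one] at this
  exact this.symm

theorem phi0_c (O : Set (E r)) (hO : IsOrbit r O) (hr : 2 ≤ r) (qh : Fˣ) (t : Fin r → Fˣ)
    (ht : t ∈ TOset F r qh O)
    (j : Fin r) : phi0 qh (cpt r O) t (cpt r O j) = t j := by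
  unfold phi0
  split_ifs with h1 h2 h3
  · exact (TO_zero O hO hr qh t ht j h1).symm
  · exact (TO_half O hO hr qh t ht j h2).symm
  · exact TO_eq' O hO hr qh t ht _ _ h3.choose_spec
  · exact absurd ⟨j, rfl⟩ h3

theorem torusAct_tht (O : Set (E r)) (hO : IsOrbit r O) (hr : 2 ≤ r) (qh : Fˣ) (t : Fin r → Fˣ)
    (ht : t ∈ TOset F r qh O)
    (y : E r) (hy : y ∈ O) (m : Fin r) :
    torusAct F r qh (gfun r y) t m = tht qh (phi0 qh (cpt r O) t) (y m) := by
  have hc := (cpt_spec O hO hr).2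
  obtain ⟨hl, hg⟩ := gW_spec O hO hr y hy
  obtain ⟨π, σ, lam, h1, h2⟩ := word_aff hr _ hl
  rw [torusAct_aff qh t (gfun r y) π σ lam h2]
  have e := h2 (cpt r O) m
  simp only [hg] at e
  rw [e, tht_c qh _ (by simp [phi0]) (by simp [phi0]) _ (hc.2 _).1 (hc.2 _).2 _ _ (h1 m),
    phi0_c O hO hr qh t ht]

end TO

/-! ### Invariance of `F[O]` -/

section Inv
variable (O : Set (E r))

theorem FO_X (y : E r) (hy : y ∈ O) : X F r y ∈ FO F r O := Submodule.subset_span ⟨y, hy, rfl⟩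

theorem FO_end (A : Module.End F (QA F r)) (h : ∀ y ∈ O, A (X F r y) ∈ FO F r O) :
    ∀ f ∈ FO F r O, A f ∈ FO F r O := by
  intro f hf
  induction hf using Submodule.span_induction with
  | mem x hx => obtain ⟨y, hy, rfl⟩ := hx; exact h y hy
  | zero => simp
  | add x y _ _ hx hy => rw [map_add]; exact add_mem hx hy
  | smul a x _ hx => rw [map_smul]; exact Submodule.smul_mem _ _ hx

theorem FO_eqOn (A B : Module.End F (QA F r)) (h : ∀ y ∈ O, A (X F r y) = B (X F r y)) :
    ∀ f ∈ FO F r O, A f = B f := by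
  intro f hf
  induction hf using Submodule.span_induction with
  | mem x hx => obtain ⟨y, hy, rfl⟩ := hx; exact h y hy
  | zero => simp
  | add x y _ _ hx hy => rw [map_add, map_add, hx, hy]
  | smul a x _ hx => rw [map_smul, map_smul, hx]

theorem geomS_FO (c : F) (v : E r) (m : ℤ) (y : E r)
    (h : ∀ n : ℤ, (n : ℝ) • v + y ∈ O) : geomS F r c v m * X F r y ∈ FO F r O := by
  unfold geomS
  split_ifs
  · rw [Finset.sum_mul]
    refine Submodule.sum_mem _ fun n _ => ?_
    rw [smul_mul_assoc, X_mul]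
    refine Submodule.smul_mem _ _ (FO_X O _ ?_)
    have := h n
    push_cast at this
    exact this
  · rw [neg_mul, Finset.sum_mul]
    refine Submodule.neg_mem _ (Submodule.sum_mem _ fun n _ => ?_)
    rw [smul_mul_assoc, X_mul]
    refine Submodule.smul_mem _ _ (FO_X O _ ?_)
    have := h (-n - 1)
    push_cast at this
    exact this


theorem O_shift (O : Set (E r)) (hO : IsOrbit r O) (hr : 2 ≤ r)
    (v : E r) (hv : ∀ m, ∃ n : ℤ, v m = n) (y : E r) (hy : y ∈ O) : v + y ∈ O := by
  refine O_all O hr (hG_of O hO hr) y _ hy fun m => ?_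
  obtain ⟨n, hn⟩ := hv m
  exact ⟨n, Or.inl (by rw [Pi.add_apply, hn, add_comm])⟩

theorem SO_FO (O : Set (E r)) (hO : IsOrbit r O) (hr : 2 ≤ r)
    (k : F) (p q : Fin r) : ∀ f ∈ FO F r O, SO k p q 1 f ∈ FO F r O := by
  refine FO_end O _ fun y hy => ?_
  rw [SO_form, SP, smul_mul_assoc]
  refine add_mem (Submodule.smul_mem _ _ (FO_X O _ ?_)) (Submodule.smul_mem _ _ (geomS_FO O _ _ _ _ ?_))
  · rw [sw_swap]; exact O_perm O hr (hG_of O hO hr) _ y hy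
  · intro n
    refine O_shift O hO hr _ (fun m => ?_) y hy
    refine ⟨n * ((if m = p then 1 else 0) - (if m = q then 1 else 0)), ?_⟩
    simp [ep, Pi.single_apply]

theorem LO_FO (O : Set (E r)) (hO : IsOrbit r O) (hr : 2 ≤ r)
    (kk uu c : F) (th : ℝ → F) (p : Fin r) (e : ℤ) :
    ∀ f ∈ FO F r O, LO kk uu c th p e f ∈ FO F r O := by
  refine FO_end O _ fun y hy => ?_
  have hs : ∀ y ∈ O, ∀ n : ℤ, (n : ℝ) • ((2 * (e : ℝ)) • ep p) + y ∈ O := by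
    intro y hy n
    refine O_shift O hO hr _ (fun m => ?_) y hy
    refine ⟨n * (2 * e * (if m = p then 1 else 0)), ?_⟩
    simp [ep, Pi.single_apply]
  rw [LO_form, LP, add_mul, smul_mul_assoc, smul_mul_assoc]
  refine add_mem (Submodule.smul_mem _ _ (FO_X O _ ?_)) (add_mem
    (Submodule.smul_mem _ _ (geomS_FO O _ _ _ _ (hs y hy))) (Submodule.smul_mem _ _ ?_))
  · exact O_ng O hr (hG_of O hO hr) _ y hy
  · rw [mul_comm (c • X F r ((e : ℝ) • ep p)), mul_assoc, smul_mul_assoc, X_mul, mul_smul_comm]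
    refine Submodule.smul_mem _ _ (geomS_FO O _ _ _ _ (hs _ ?_))
    refine O_shift O hO hr _ (fun m => ?_) y hy
    refine ⟨e * (if m = p then 1 else 0), ?_⟩
    simp [ep, Pi.single_apply]

theorem TG_FO (O : Set (E r)) (hO : IsOrbit r O) (hr : 2 ≤ r)
    (qh k0 u0 k kr ur : F) (th : ℝ → F) (j : ℕ) (hj : j ≤ r) :
    ∀ f ∈ FO F r O, TG qh k0 u0 k kr ur th hr j f ∈ FO F r O := by
  rcases Nat.eq_zero_or_pos j with rfl | h
  · rw [TG_zero]
    have := LO_FO (F := F) O hO hr k0 u0 qh th ⟨0, by omega⟩ (-1)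
    push_cast at this
    exact this
  rcases hj.lt_or_eq with h1 | rfl
  · rw [TG_SO _ _ _ _ _ _ _ hr j h h1]; exact SO_FO O hO hr _ _ _
  · rw [TG_LO]
    have := LO_FO (F := F) O hO hr kr ur 1 (fun _ => 1) ⟨j - 1, by omega⟩ 1
    push_cast at this
    exact this

end Inv
end Theta

theorem final (hr : 2 ≤ r)
    (qh k0 u0 k kr ur : Fˣ) (O : Set (E r)) (hO : IsOrbit r O)
    (t : Fin r → Fˣ) (ht : t ∈ TOset F r qh O) :
    ∀ i j : ℕ, 1 ≤ i → i ≤ r → 1 ≤ j → j ≤ r → ∀ f ∈ FO F r O,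
      Yop F r qh (k0 : F) (u0 : F) (k : F) (kr : F) (ur : F) t i
          (Yop F r qh (k0 : F) (u0 : F) (k : F) (kr : F) (ur : F) t j f)
        = Yop F r qh (k0 : F) (u0 : F) (k : F) (kr : F) (ur : F) t j
            (Yop F r qh (k0 : F) (u0 : F) (k : F) (kr : F) (ur : F) t i f) := by
  intro i j hi hi' hj hj' f hf
  refine reduction qh k0 u0 k kr ur (fun s => ((tht qh (phi0 qh (cpt r O) t) (-s) : Fˣ) : F)) hr
    (tht_ok qh _ (by simp [phi0]) (by simp [phi0])) t (FO F r O) ?_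
    (fun j hj => TG_FO O hO hr _ _ _ _ _ _ _ j hj) i j hi hi' hj hj' f hf
  refine FO_eqOn O _ _ fun y hy => ?_
  rw [TG_zero, T0op, LO, mkOp_X, mkOp_X]
  refine T0el_LEl qh _ _ t ⟨0, by omega⟩ rfl _ y ?_
  rw [torusAct_tht O hO hr qh t ht y hy]
  simp

/-- The operators `Y_1^𝒪, …, Y_r^𝒪` on `F[𝒪]` pairwise commute. -/
theorem statement6 (F : Type*) [Field F] [CharZero F] (r : ℕ) (hr : 2 ≤ r)
    (qh k0 u0 k kr ur : Fˣ) (O : Set (E r)) (hO : IsOrbit r O)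
    (t : Fin r → Fˣ) (ht : t ∈ TOset F r qh O) :
    ∀ i j : ℕ, 1 ≤ i → i ≤ r → 1 ≤ j → j ≤ r → ∀ f ∈ FO F r O,
      Yop F r qh (k0 : F) (u0 : F) (k : F) (kr : F) (ur : F) t i
          (Yop F r qh (k0 : F) (u0 : F) (k : F) (kr : F) (ur : F) t j f)
        = Yop F r qh (k0 : F) (u0 : F) (k : F) (kr : F) (ur : F) t j
            (Yop F r qh (k0 : F) (u0 : F) (k : F) (kr : F) (ur : F) t i f) := by
  exact final F r hr qh k0 u0 k kr ur O hO t ht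

end QP

end
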